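/- Let 0 < q < 1, set s = q^{−1/2}, let n ≥ 1, and let u₁,…,u_n be pairwise distinct reals with u_i > q^{−1/2} for all i and u_i ≠ q·u_j for all i, j. Fix r > q^{−1}, an integer ℓ ≥ 1, and integers x₁ ≥ x₂ ≥ … ≥ x_ℓ ≥ 1. Then there exist δ₀, ρ₀ > 0 such that for all δ ∈ (0,δ₀) and ρ ∈ (0,ρ₀), the q-moments of the height function of the stochastic six vertex model satisfy: Σ_{ν ∈ Sign⁺_n} M^{6v}_{u}(ν) · ∏_{i=1}^ℓ q^{h_ν(x_i)} = q^{ℓ(ℓ−1)/2} · (2πi)^{−ℓ} ∮_{γ[ū|1]} ⋯ ∮_{γ[ū|ℓ]} ∏_{1≤α<β≤ℓ} (w_α−w_β)/(w_α−qw_β) · ∏_{i=1}^ℓ [ w_i^{−1} · ((1−q^{−1/2} w_i)/(1−q^{1/2} w_i))^{x_i−1} · ∏_{j=1}^n (1−q u_j w_i)/(1−u_j w_i) ] dw₁⋯dw_ℓ, where the series on the left converges absolutely, γ[ū|j] is the union of the positively oriented circles of radius δ centered at u₁^{−1},…,u_n^{−1} together with the positively oriented circle of radius r^j·ρ centered at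 0 (the variable w_j is integrated over γ[ū|j], and an integral over a union of circles means the sum of the corresponding circle integrals). -/

import Mathlib

open Finset

noncomputable section

/-- The finite q-Pochhammer symbol `(a;q)_m = ∏_{i=0}^{m-1} (1 - a q^i)`. -/
def qPoch {K : Type*} [CommRing K] (a q : K) (m : ℕ) : K :=
  ∏ i ∈ Finset.range m, (1 - a * q ^ i)

/-- Signatures of length `n`: weakly decreasing tuples of nonnegative integers. -/
abbrev Sign (n : ℕ) : Type :=
  {ν : Fin n → ℕ // ∀ i j : Fin n, i ≤ j → ν j ≤ ν i}

/-- The symmetric rational function `F_μ(u₁,…,u_M)` (symmetrization formula (4.20)). -/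
def Ffun (q s : ℂ) {M : ℕ} (μ : Fin M → ℕ) (u : Fin M → ℂ) : ℂ :=
  ((1 - q) ^ M / ∏ i, (1 - s * u i)) *
    ∑ σ : Equiv.Perm (Fin M),
      (∏ p ∈ (Finset.univ : Finset (Fin M × Fin M)).filter (fun p => p.1 < p.2),
        (u (σ p.1) - q * u (σ p.2)) / (u (σ p.1) - u (σ p.2))) *
      ∏ i, ((u (σ i) - s) / (1 - s * u (σ i))) ^ (μ i)

/-- Multiplicity of the value `k` among the parts of `lam`. -/
def mult {n : ℕ} (lam : Fin n → ℕ) (k : ℕ) : ℕ :=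
  ((Finset.univ : Finset (Fin n)).filter (fun i => lam i = k)).card

/-- The conjugation constant `c(λ) = ∏_{k≥0} (s²;q)_{m_k}/(q;q)_{m_k}`. -/
def cconst (q s : ℂ) {n : ℕ} (lam : Fin n → ℕ) : ℂ :=
  ∏ᶠ k : ℕ, qPoch (s ^ 2) q (mult lam k) / qPoch q q (mult lam k)

/-- `F^c_λ = c(λ)·F_λ`. -/
def Fc (q s : ℂ) {M : ℕ} (μ : Fin M → ℕ) (u : Fin M → ℂ) : ℂ :=
  cconst q s μ * Ffun q s μ u

/-- The symmetric rational function `G_ν(v₁,…,v_N)` (symmetrization formula (4.21)). -/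
def Gfun (q s : ℂ) {n N : ℕ} (ν : Fin n → ℕ) (v : Fin N → ℂ) : ℂ :=
  if h : n - mult ν 0 ≤ N then
    (qPoch (s ^ 2) q n / (qPoch q q (N - (n - mult ν 0)) * qPoch (s ^ 2) q (mult ν 0))) *
      ((1 - q) ^ N / ∏ j, (1 - s * v j)) *
      ∑ σ : Equiv.Perm (Fin N),
        (∏ p ∈ (Finset.univ : Finset (Fin N × Fin N)).filter (fun p => p.1 < p.2),
          (v (σ p.1) - q * v (σ p.2)) / (v (σ p.1) - v (σ p.2))) *
        (∏ j : Fin (n - mult ν 0),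
          ((v (σ (Fin.castLE h j)) - s) / (1 - s * v (σ (Fin.castLE h j)))) ^
            (ν (Fin.castLE (Nat.sub_le n (mult ν 0)) j))) *
        (∏ i : Fin (n - mult ν 0), v (σ (Fin.castLE h i)) / (v (σ (Fin.castLE h i)) - s)) *
        (∏ j ∈ (Finset.univ : Finset (Fin N)).filter (fun j : Fin N => n - mult ν 0 ≤ (j : ℕ)),
          (1 - s * q ^ (mult ν 0) * v (σ j)))
  else 0

/-- Iterated integral: `iterInt k ops f` applies the integration functional `ops i` to the
`i`-th variable (outermost first). -/
def iterInt : (k : ℕ) → (Fin k → ((ℂ → ℂ) → ℂ)) → ((Fin k → ℂ) → ℂ) → ℂ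
  | 0, _, f => f Fin.elim0
  | k + 1, ops, f => ops 0 (fun z => iterInt k (fun i => ops i.succ) (fun u => f (Fin.cons z u)))

/-- The weight `M_{u;ρ}(ν) = 1_{ν_n ≥ 1}·(−s)^{|ν|−n}·F^c_{ν−1^n}(u)` of the (higher spin) six
vertex model at time `n`, started from the empty configuration. -/
def Mwt (q s : ℂ) {n : ℕ} (u : Fin n → ℂ) (ν : Fin n → ℕ) : ℂ :=
  (if ∀ i, 1 ≤ ν i then (1 : ℂ) else 0) * (-s) ^ (∑ i, ν i - n) *
    Fc q s (fun i => ν i - 1) u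

/-- The height function `h_ν(x) = #{j : ν_j ≥ x}`. -/
def height {n : ℕ} (ν : Fin n → ℕ) (x : ℕ) : ℕ :=
  ((Finset.univ : Finset (Fin n)).filter (fun j => x ≤ ν j)).card

/-- Partial fraction identity: `q`-counting of a finite set of spectral parameters. -/
theorem q_pow_card_eq_sum {ι : Type*} [DecidableEq ι] (q : ℂ) (u : ι → ℂ)
    (hinj : Function.Injective u) (h0 : ∀ a, u a ≠ 0) (U : Finset ι) :
    q ^ U.card = 1 + ∑ a ∈ U, (∏ b ∈ U.erase a, (u a - q * u b) / (u a - u b)) * (q - 1) := by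
  set v : Option ι → ℂ := fun o => o.elim 0 u with hv
  have hvinj : Set.InjOn v (Finset.insertNone U : Finset (Option ι)) := by
    rintro (_ | a) - (_ | b) - h
    · rfl
    · exact absurd h.symm (h0 b)
    · exact absurd h (h0 a)
    · exact congrArg some (hinj h)
  set P : Polynomial ℂ := ∏ b ∈ U, (Polynomial.X - Polynomial.C (q * u b)) with hP
  have hmonic : P.Monic := Polynomial.monic_prod_of_monic _ _ fun b _ => Polynomial.monic_X_sub_C _
  have hdeg : P.degree = U.card := by
    rw [hP, Polynomial.degree_prod]
    simp only [Polynomial.degree_X_sub_C]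
    simp
  have key := Lagrange.leadingCoeff_eq_sum hvinj (P := P) (by rw [hdeg]; simp)
  rw [hmonic.leadingCoeff, Finset.sum_insertNone] at key
  have e0 : (Finset.insertNone U).erase none = U.map Function.Embedding.some := by
    ext o; cases o <;> simp
  have e1 (a : ι) : (Finset.insertNone U).erase (some a) = Finset.insertNone (U.erase a) := by
    ext o; cases o <;> simp
  simp only [e0, e1, Finset.prod_map, Finset.prod_insertNone, hv, Option.elim, hP,
    Polynomial.eval_prod, Polynomial.eval_sub, Polynomial.eval_X, Polynomial.eval_C,
    Function.Embedding.some_apply, sub_zero] at key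
  rw [← Finset.prod_div_distrib] at key
  have e2 : ∏ i ∈ U, (0 - q * u i) / (0 - u i) = q ^ U.card := by
    rw [← Finset.prod_const]
    refine Finset.prod_congr rfl fun i _ => ?_
    have := h0 i
    field_simp
    ring
  rw [e2] at key
  rw [eq_comm, ← eq_sub_iff_add_eq'] at key
  have e3 : ∑ a ∈ U, (∏ b ∈ U.erase a, (u a - q * u b) / (u a - u b)) * (q - 1)
      = -∑ a ∈ U, (∏ b ∈ U, (u a - q * u b)) / (u a * ∏ b ∈ U.erase a, (u a - u b)) := by
    rw [← Finset.sum_neg_distrib]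
    refine Finset.sum_congr rfl fun a ha => ?_
    rw [← Finset.mul_prod_erase _ _ ha, Finset.prod_div_distrib]
    have h1 := h0 a
    have h2 : ∏ b ∈ U.erase a, (u a - u b) ≠ 0 :=
      Finset.prod_ne_zero_iff.2 fun b hb => sub_ne_zero.2 fun h =>
        (Finset.ne_of_mem_erase hb) (hinj h).symm
    field_simp
    ring
  rw [e3, key]
  ring

/-- Partial fraction identity behind the normalization of the six vertex weights. -/
theorem one_sub_prod_eq_sum {ι : Type*} [DecidableEq ι] (q s : ℂ)
    (hs : q * s ^ 2 = 1) (u y : ι → ℂ) (hinj : Function.Injective u) (h0 : ∀ a, u a ≠ 0)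
    (h1 : ∀ a, s * u a ≠ 1) (hsu : ∀ a, u a ≠ s)
    (hy : ∀ a, y a = (s * u a - s ^ 2) / (s * u a - 1)) (U : Finset ι) :
    1 - ∏ a ∈ U, y a =
      ∑ a ∈ U, (∏ b ∈ U.erase a, (u b - q * u a) / (u b - u a)) *
        (∏ b ∈ U.erase a, y b) * (1 - y a) := by
  have hs0 : s ≠ 0 := by rintro rfl; simp at hs
  set v : Option (Option ι) → ℂ := fun o => o.elim 0 (fun o => o.elim s u) with hv
  have hvinj : Set.InjOn v (Finset.insertNone (Finset.insertNone U)) := by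
    rintro (_ | _ | a) - (_ | _ | b) - h
    · rfl
    · exact absurd h.symm hs0
    · exact absurd h.symm (h0 b)
    · exact absurd h hs0
    · rfl
    · exact absurd h.symm (hsu b)
    · exact absurd h (h0 a)
    · exact absurd h (hsu a)
    · exact congrArg (fun x => some (some x)) (hinj h)
  set P : Polynomial ℂ := ∏ b ∈ U, (Polynomial.C q * Polynomial.X - Polynomial.C (u b)) with hP
  have hdeg : P.degree ≤ U.card := by
    rw [hP, Polynomial.degree_prod]
    refine (Finset.sum_le_card_nsmul _ _ 1 fun b _ => ?_).trans (by simp)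
    compute_degree
  have hcoeff : P.coeff (U.card + 1) = 0 :=
    Polynomial.coeff_eq_zero_of_degree_lt (hdeg.trans_lt (by norm_cast; omega))
  have key := Lagrange.coeff_eq_sum hvinj (P := P) (hdeg.trans_lt (by simp; norm_cast; omega))
  rw [show (Finset.insertNone (Finset.insertNone U)).card - 1 = U.card + 1 by simp, hcoeff,
    Finset.sum_insertNone, Finset.sum_insertNone] at key
  have e0 : (Finset.insertNone (Finset.insertNone U)).erase none =
      (Finset.insertNone U).map Function.Embedding.some := by
    ext o; cases o <;> simp
  have e0' : (Finset.insertNone (Finset.insertNone U)).erase (some none) =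
      Finset.insertNone (U.map Function.Embedding.some) := by
    ext o; rcases o with _ | _ | o <;> simp
  have e1 (a : ι) : (Finset.insertNone (Finset.insertNone U)).erase (some (some a)) =
      Finset.insertNone (Finset.insertNone (U.erase a)) := by
    ext o; rcases o with _ | _ | o <;> simp
  simp only [e0, e0', e1, Finset.prod_map, Finset.prod_insertNone, hv, Option.elim, hP,
    Polynomial.eval_prod, Polynomial.eval_sub, Polynomial.eval_mul, Polynomial.eval_X,
    Polynomial.eval_C, Function.Embedding.some_apply, sub_zero] at key
  have hyne (a : ι) : y a ≠ 0 := by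
    rw [hy, div_ne_zero_iff]
    refine ⟨?_, sub_ne_zero.2 (h1 a)⟩
    rw [show s * u a - s ^ 2 = s * (u a - s) by ring]
    exact mul_ne_zero hs0 (sub_ne_zero.2 (hsu a))
  have hY : ∏ a ∈ U, y a ≠ 0 := Finset.prod_ne_zero_iff.2 fun a _ => hyne a
  have f0 : (∏ x ∈ U, (q * 0 - u x)) / ((0 - s) * ∏ x ∈ U, (0 - u x)) = -s⁻¹ := by
    have : ∏ x ∈ U, (0 - u x) ≠ 0 := Finset.prod_ne_zero_iff.2 fun a _ => by simpa using h0 a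
    simp only [mul_zero]
    field_simp
    simp
  have f1 : (∏ x ∈ U, (q * s - u x)) / (s * ∏ x ∈ U, (s - u x)) = s⁻¹ * (∏ a ∈ U, y a)⁻¹ := by
    rw [mul_comm s (∏ x ∈ U, (s - u x)), ← div_div, ← Finset.prod_div_distrib,
      ← Finset.prod_inv_distrib, div_eq_mul_inv, mul_comm]
    congr 1
    refine Finset.prod_congr rfl fun a _ => ?_
    have h2 := sub_ne_zero.2 (h1 a)
    have h3 : s - u a ≠ 0 := sub_ne_zero.2 (hsu a).symm
    have h4 : s * u a - s ^ 2 ≠ 0 := by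
      rw [show s * u a - s ^ 2 = -(s * (s - u a)) by ring]
      exact neg_ne_zero.2 (mul_ne_zero hs0 h3)
    rw [hy, inv_div, div_eq_div_iff h3 h4]
    linear_combination (u a - s) * hs
  rw [f0, f1] at key
  have f2 : ∑ a ∈ U, (∏ b ∈ U.erase a, (u b - q * u a) / (u b - u a)) *
        (∏ b ∈ U.erase a, y b) * (1 - y a) = -(s * ∏ a ∈ U, y a) *
      ∑ a ∈ U, (∏ b ∈ U, (q * u a - u b)) /
        (u a * ((u a - s) * ∏ b ∈ U.erase a, (u a - u b))) := by
    rw [Finset.mul_sum]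
    refine Finset.sum_congr rfl fun a ha => ?_
    rw [← Finset.mul_prod_erase _ y ha, ← Finset.mul_prod_erase _ (fun b => q * u a - u b) ha]
    have g1 : ∏ b ∈ U.erase a, (u b - q * u a) / (u b - u a) =
        (∏ b ∈ U.erase a, (q * u a - u b)) / ∏ b ∈ U.erase a, (u a - u b) := by
      rw [← Finset.prod_div_distrib]
      refine Finset.prod_congr rfl fun b _ => ?_
      rw [← neg_sub, ← neg_sub (u a), neg_div_neg_eq]
    have g2 : ∏ b ∈ U.erase a, (u a - u b) ≠ 0 :=
      Finset.prod_ne_zero_iff.2 fun b hb => sub_ne_zero.2 fun h =>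
        (Finset.ne_of_mem_erase hb) (hinj h).symm
    have g3 : 1 - y a = -(s * y a * (q - 1) / (u a - s)) := by
      rw [hy]
      have h2 := sub_ne_zero.2 (h1 a)
      have h3 := sub_ne_zero.2 (hsu a)
      field_simp
      linear_combination hs
    rw [g1, g3]
    have h2 := sub_ne_zero.2 (hsu a)
    have h3 := h0 a
    field_simp
  rw [f2]
  have : (∑ a ∈ U, (∏ b ∈ U, (q * u a - u b)) /
        (u a * ((u a - s) * ∏ b ∈ U.erase a, (u a - u b)))) =
        s⁻¹ - s⁻¹ * (∏ a ∈ U, y a)⁻¹ := by linear_combination -key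
  rw [this]
  field_simp
  ring

/-- The shuffle product of two functions of finite sets of labels, twisted by the pair weights
`c a b` for `a` in the first and `b` in the second block. -/
def shuffle {ι : Type*} [DecidableEq ι] (c : ι → ι → ℂ) (A B : Finset ι → ℂ) (U : Finset ι) : ℂ :=
  ∑ K ∈ U.powerset, (∏ a ∈ K, ∏ b ∈ U \ K, c a b) * A K * B (U \ K)

/-- The element of the shuffle algebra equal to `1` at the empty set, to `f a` at `{a}`, and to `0`
at sets with at least two elements. -/
def gen {ι : Type*} (f : ι → ℂ) (U : Finset ι) : ℂ :=
  if U.card ≤ 1 then ∏ a ∈ U, f a else 0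

theorem gen_empty {ι : Type*} (f : ι → ℂ) : gen f ∅ = 1 := by simp [gen]

theorem gen_singleton {ι : Type*} (f : ι → ℂ) (a : ι) : gen f {a} = f a := by simp [gen]

section ShuffleAlgebra

variable {ι : Type*} [DecidableEq ι] (c : ι → ι → ℂ)

theorem shuffle_flip (A B : Finset ι → ℂ) (U : Finset ι) :
    shuffle c A B U = shuffle (fun a b => c b a) B A U := by
  unfold shuffle
  refine Finset.sum_nbij' (U \ ·) (U \ ·) (fun K _ => by simp) (fun K _ => by simp)
    (fun K hK => ?_) (fun K hK => ?_) (fun K hK => ?_)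
  · exact Finset.sdiff_sdiff_eq_self (Finset.mem_powerset.1 hK)
  · exact Finset.sdiff_sdiff_eq_self (Finset.mem_powerset.1 hK)
  · rw [Finset.sdiff_sdiff_eq_self (Finset.mem_powerset.1 hK), Finset.prod_comm]
    ring

theorem gen_shuffle (f : ι → ℂ) (B : Finset ι → ℂ) (U : Finset ι) :
    shuffle c (gen f) B U =
      B U + ∑ a ∈ U, (∏ b ∈ U.erase a, c a b) * f a * B (U.erase a) := by
  unfold shuffle
  have hsub : insert ∅ (U.image fun a => ({a} : Finset ι)) ⊆ U.powerset := by
    intro K hK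
    rw [Finset.mem_insert, Finset.mem_image] at hK
    rcases hK with rfl | ⟨a, ha, rfl⟩
    · simp
    · simpa using ha
  rw [← Finset.sum_subset hsub, Finset.sum_insert (by simp), Finset.sum_image (by simp)]
  · simp [gen_empty, gen_singleton, Finset.sdiff_singleton_eq_erase]
  · intro K hK hK'
    have : ¬ K.card ≤ 1 := by
      intro h
      apply hK'
      rcases K.eq_empty_or_nonempty with rfl | hne
      · simp
      · obtain ⟨a, rfl⟩ := Finset.card_eq_one.1 (le_antisymm h hne.card_pos)
        refine Finset.mem_insert_of_mem (Finset.mem_image.2 ⟨a, ?_, rfl⟩)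
        simpa using hK
    simp [gen, this]

theorem shuffle_gen (f : ι → ℂ) (A : Finset ι → ℂ) (U : Finset ι) :
    shuffle c A (gen f) U =
      A U + ∑ a ∈ U, (∏ b ∈ U.erase a, c b a) * f a * A (U.erase a) := by
  rw [shuffle_flip, gen_shuffle]

theorem shuffle_assoc (A B C : Finset ι → ℂ) :
    shuffle c (shuffle c A B) C = shuffle c A (shuffle c B C) := by
  funext U
  unfold shuffle
  simp only [Finset.mul_sum, Finset.sum_mul]
  rw [Finset.sum_sigma', Finset.sum_sigma']
  refine Finset.sum_nbij' (fun x => ⟨x.2, x.1 \ x.2⟩) (fun x => ⟨x.1 ∪ x.2, x.1⟩) ?_ ?_ ?_ ?_ ?_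
  · rintro ⟨L, K⟩ h
    simp only [Finset.mem_sigma, Finset.mem_powerset] at h ⊢
    exact ⟨h.2.trans h.1, Finset.sdiff_subset_sdiff h.1 le_rfl⟩
  · rintro ⟨K, M⟩ h
    simp only [Finset.mem_sigma, Finset.mem_powerset] at h ⊢
    exact ⟨Finset.union_subset h.1 (h.2.trans Finset.sdiff_subset), Finset.subset_union_left⟩
  · rintro ⟨L, K⟩ h
    simp only [Finset.mem_sigma, Finset.mem_powerset] at h
    simp [Finset.union_sdiff_of_subset h.2]
  · rintro ⟨K, M⟩ h
    simp only [Finset.mem_sigma, Finset.mem_powerset] at h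
    have hd : Disjoint M K := Finset.disjoint_of_subset_left h.2 Finset.sdiff_disjoint
    have : (K ∪ M) \ K = M := by rw [Finset.union_sdiff_left, Finset.sdiff_eq_self_of_disjoint hd]
    simp [this]
  · rintro ⟨L, K⟩ h
    simp only [Finset.mem_sigma, Finset.mem_powerset] at h
    obtain ⟨hL, hK⟩ := h
    have e1 : (U \ K) \ (L \ K) = U \ L := by
      ext x; simp only [Finset.mem_sdiff]; have := @hK x; tauto
    have e2 : ∏ a ∈ L, ∏ b ∈ U \ L, c a b =
        (∏ a ∈ K, ∏ b ∈ U \ L, c a b) * ∏ a ∈ L \ K, ∏ b ∈ U \ L, c a b := by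
      rw [mul_comm, Finset.prod_sdiff hK]
    have e3 : ∏ a ∈ K, ∏ b ∈ U \ K, c a b =
        (∏ a ∈ K, ∏ b ∈ U \ L, c a b) * ∏ a ∈ K, ∏ b ∈ L \ K, c a b := by
      rw [← Finset.prod_mul_distrib]
      refine Finset.prod_congr rfl fun a _ => ?_
      rw [← e1, Finset.prod_sdiff (Finset.sdiff_subset_sdiff hL le_rfl)]
    dsimp only
    rw [e1, e2, e3]
    ring

end ShuffleAlgebra

/-- The configuration weights with all particles below level `N`: the shuffle product of one
generator for each level. -/
def boxSum {ι : Type*} [DecidableEq ι] (c : ι → ι → ℂ) (s : ℕ → ι → ℂ) : ℕ → Finset ι → ℂ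
  | 0 => gen 0
  | N + 1 => shuffle c (gen (s N)) (boxSum c s N)

/-- The weight of a pair of labels `a`, `b` located at `m a` and `m b`. -/
def pairWt {ι : Type*} [DecidableEq ι] (c : ι → ι → ℂ) (m : ι → ℕ) (a b : ι) : ℂ :=
  if m b < m a then c a b else if m a = m b ∧ a ≠ b then 0 else 1

/-- The weight of the configuration with the labels `a ∈ U` located at `m a`. -/
def configWt {ι : Type*} [DecidableEq ι] (c : ι → ι → ℂ) (s : ℕ → ι → ℂ) (U : Finset ι)
    (m : ι → ℕ) : ℂ :=
  (∏ a ∈ U, ∏ b ∈ U, pairWt c m a b) * ∏ a ∈ U, s (m a) a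

section BoxSum

variable {ι : Type*} [DecidableEq ι] (c : ι → ι → ℂ)

theorem configWt_eq_zero (s : ℕ → ι → ℂ) {U : Finset ι} {m : ι → ℕ} {a b : ι} (ha : a ∈ U)
    (hb : b ∈ U) (hab : a ≠ b) (h : m a = m b) : configWt c s U m = 0 := by
  unfold configWt
  rw [Finset.prod_eq_zero ha, zero_mul]
  rw [Finset.prod_eq_zero hb]
  simp [pairWt, h, hab]

theorem configWt_update (s : ℕ → ι → ℂ) {U : Finset ι} {m : ι → ℕ} {a : ι} (ha : a ∈ U) {N : ℕ}
    (hm : ∀ b ∈ U.erase a, m b < N) :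
    configWt c s U (Function.update m a N) =
      (∏ b ∈ U.erase a, c a b) * s N a * configWt c s (U.erase a) m := by
  unfold configWt
  rw [← Finset.mul_prod_erase _ _ ha, ← Finset.mul_prod_erase _ _ ha,
    ← Finset.mul_prod_erase U (fun b => s _ b) ha]
  have e0 : pairWt c (Function.update m a N) a a = 1 := by simp [pairWt]
  have e1 : ∏ b ∈ U.erase a, pairWt c (Function.update m a N) a b = ∏ b ∈ U.erase a, c a b := by
    refine Finset.prod_congr rfl fun b hb => ?_
    have := hm b hb
    simp [pairWt, Function.update_of_ne (Finset.ne_of_mem_erase hb), this]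
  have e2 : ∏ x ∈ U.erase a, ∏ b ∈ U, pairWt c (Function.update m a N) x b =
      ∏ x ∈ U.erase a, ∏ b ∈ U.erase a, pairWt c m x b := by
    refine Finset.prod_congr rfl fun x hx => ?_
    rw [← Finset.mul_prod_erase _ _ ha]
    have hxa := Finset.ne_of_mem_erase hx
    have h1 : pairWt c (Function.update m a N) x a = 1 := by
      have := hm x hx
      simp [pairWt, Function.update_of_ne hxa, this.le, this.ne]
    rw [h1, one_mul]
    refine Finset.prod_congr rfl fun b hb => ?_
    simp [pairWt, Function.update_of_ne hxa, Function.update_of_ne (Finset.ne_of_mem_erase hb)]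
  have e3 : ∏ x ∈ U.erase a, s (Function.update m a N x) x = ∏ x ∈ U.erase a, s (m x) x := by
    refine Finset.prod_congr rfl fun x hx => ?_
    rw [Function.update_of_ne (Finset.ne_of_mem_erase hx)]
  rw [e0, e1, e2, e3, Function.update_self]
  ring

theorem boxSum_eq_sum_configWt [Fintype ι] (s : ℕ → ι → ℂ) (N : ℕ) (U : Finset ι) :
    boxSum c s N U = ∑ m ∈ Fintype.piFinset (fun a => if a ∈ U then Finset.range N else {0}),
      configWt c s U m := by
  induction N generalizing U with
  | zero =>
    rcases U.eq_empty_or_nonempty with rfl | ⟨a, ha⟩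
    · simp [boxSum, gen, configWt]
    · have h1 : Fintype.piFinset (fun a => if a ∈ U then Finset.range 0 else {0}) = ∅ := by
        refine Fintype.piFinset_eq_empty.2 ⟨a, by simp [ha]⟩
      rw [h1, Finset.sum_empty, boxSum, gen]
      split_ifs
      · exact Finset.prod_eq_zero ha rfl
      · rfl
  | succ N ih =>
    rw [boxSum, gen_shuffle]
    have hsub : Fintype.piFinset (fun a => if a ∈ U then Finset.range N else {0}) ⊆
        Fintype.piFinset (fun a => if a ∈ U then Finset.range (N + 1) else {0}) := by
      refine Fintype.piFinset_subset _ _ fun a => ?_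
      split_ifs
      · exact Finset.range_subset_range.2 (Nat.le_succ N)
      · exact le_rfl
    rw [← Finset.sum_sdiff hsub, add_comm, ih]
    congr 1
    simp only [ih, Finset.mul_sum]
    rw [Finset.sum_sigma']
    refine Finset.sum_of_injOn (fun x => Function.update x.2 x.1 N) ?_ ?_ ?_ ?_
    · rintro ⟨a, m⟩ h ⟨b, m'⟩ h' heq
      simp only [Finset.coe_sigma, Set.mem_sigma_iff, Finset.mem_coe, Fintype.mem_piFinset] at h h'
      dsimp only at heq
      have hab : a = b := by
        by_contra hab
        have h1 := congrFun heq a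
        rw [Function.update_self, Function.update_of_ne hab] at h1
        have h2 := h'.2 a
        rw [if_pos (Finset.mem_erase.2 ⟨hab, h.1⟩), Finset.mem_range] at h2
        omega
      subst hab
      have hm : m = m' := by
        funext x
        by_cases hx : x = a
        · subst hx
          have h1 := h.2 x
          have h2 := h'.2 x
          simp at h1 h2
          rw [h1, h2]
        · simpa [Function.update_of_ne hx] using congrFun heq x
      rw [hm]
    · rintro ⟨a, m⟩ h
      simp only [Finset.coe_sigma, Set.mem_sigma_iff, Finset.mem_coe, Fintype.mem_piFinset] at h
      rw [Finset.mem_coe, Finset.mem_sdiff, Fintype.mem_piFinset, Fintype.mem_piFinset]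
      constructor
      · intro x
        by_cases hx : x = a
        · subst hx
          simp [h.1]
        · have := h.2 x
          simp only [Finset.mem_erase, hx, ne_eq, not_false_eq_true, true_and] at this
          dsimp only
          rw [Function.update_of_ne hx]
          split_ifs at this ⊢
          · exact Finset.range_subset_range.2 (Nat.le_succ N) this
          · exact this
      · intro h'
        have := h' a
        simp [h.1] at this
    · intro m hm hm'
      rw [Finset.mem_sdiff, Fintype.mem_piFinset, Fintype.mem_piFinset] at hm
      obtain ⟨h1, h2⟩ := hm
      push Not at h2
      obtain ⟨a, ha⟩ := h2
      have haU : a ∈ U := by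
        by_contra haU
        have := h1 a
        rw [if_neg haU] at this ha
        exact ha this
      have hmN : m a = N := by
        have := h1 a
        rw [if_pos haU, Finset.mem_range] at this ha
        omega
      by_cases hex : ∃ b ∈ U, b ≠ a ∧ m b = N
      · obtain ⟨b, hb, hba, hbN⟩ := hex
        exact configWt_eq_zero c s haU hb hba.symm (hmN.trans hbN.symm)
      · push Not at hex
        refine absurd ⟨⟨a, Function.update m a 0⟩, ?_, ?_⟩ hm'
        · simp only [Finset.coe_sigma, Set.mem_sigma_iff, Finset.mem_coe, Fintype.mem_piFinset]
          refine ⟨haU, fun x => ?_⟩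
          by_cases hx : x = a
          · subst hx; simp
          · have := h1 x
            rw [Function.update_of_ne hx]
            simp only [Finset.mem_erase, hx, ne_eq, not_false_eq_true, true_and]
            split_ifs at this ⊢ with hxU
            · have h3 := hex x hxU hx
              rw [Finset.mem_range] at this ⊢
              omega
            · exact this
        · dsimp only
          rw [Function.update_idem, ← hmN, Function.update_eq_self]
    · rintro ⟨a, m⟩ h
      simp only [Finset.mem_sigma, Fintype.mem_piFinset] at h
      refine (configWt_update c s h.1 fun b hb => ?_).symm
      have := h.2 b
      rwa [if_pos hb, Finset.mem_range] at this

end BoxSum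

/-- The multiplicative function `U ↦ ∏_{a ∈ U} t y_a^{k-1}`. -/
def powWt {ι : Type*} (t : ℂ) (y : ι → ℂ) (k : ℕ) (U : Finset ι) : ℂ :=
  ∏ a ∈ U, t * y a ^ (k - 1)

/-- The weight of a particle at level `k`, with an additional factor `t k`. -/
def levelWt {ι : Type*} (y : ι → ℂ) (t : ℕ → ℂ) (k : ℕ) (a : ι) : ℂ :=
  (y a ^ (k - 1) - y a ^ k) * t k

/-- The factor `∏_i q^{1_{X_i ≤ k}}` contributed by a particle at level `k` to the `q`-moment. -/
def heightWt (q : ℂ) {l : ℕ} (X : Fin l → ℕ) (k : ℕ) : ℂ :=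
  ∏ i, if X i ≤ k then q else 1

/-- The `q`-moments as iterated shuffle products with one generator for each observation point. -/
def qMoment {ι : Type*} [DecidableEq ι] (c : ι → ι → ℂ) (q : ℂ) (y : ι → ℂ) :
    (l : ℕ) → (Fin l → ℕ) → Finset ι → ℂ
  | 0, _ => fun _ => 1
  | l + 1, X => shuffle c (gen fun a => (q - 1) * q ^ l * y a ^ (X 0 - 1))
      (qMoment c q y l fun i => X i.succ)

section Moments

variable {ι : Type*} [DecidableEq ι] {c : ι → ι → ℂ} {y : ι → ℂ} {q : ℂ}

theorem powWt_shuffle_levelWt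
    (hnorm : ∀ U : Finset ι, 1 - ∏ a ∈ U, y a =
      ∑ a ∈ U, (∏ b ∈ U.erase a, c b a) * (∏ b ∈ U.erase a, y b) * (1 - y a))
    (t : ℕ → ℂ) (k : ℕ) :
    shuffle c (powWt (t k) y (k + 1)) (gen (levelWt y t k)) = powWt (t k) y k := by
  funext U
  rw [shuffle_gen]
  rcases k with _ | k
  · simp [powWt, levelWt]
  · have h := hnorm U
    have e1 : powWt (t (k + 1)) y (k + 1 + 1) U =
        (∏ a ∈ U, y a) * powWt (t (k + 1)) y (k + 1) U := by
      simp only [powWt, ← Finset.prod_mul_distrib]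
      refine Finset.prod_congr rfl fun a _ => ?_
      simp only [Nat.add_sub_cancel]
      ring
    have e2 : ∑ a ∈ U, (∏ b ∈ U.erase a, c b a) * levelWt y t (k + 1) a *
        powWt (t (k + 1)) y (k + 1 + 1) (U.erase a) = (∑ a ∈ U, (∏ b ∈ U.erase a, c b a) *
          (∏ b ∈ U.erase a, y b) * (1 - y a)) * powWt (t (k + 1)) y (k + 1) U := by
      rw [Finset.sum_mul]
      refine Finset.sum_congr rfl fun a ha => ?_
      have e3 : powWt (t (k + 1)) y (k + 1 + 1) (U.erase a) =
          (∏ a ∈ U.erase a, y a) * powWt (t (k + 1)) y (k + 1) (U.erase a) := by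
        simp only [powWt, ← Finset.prod_mul_distrib]
        refine Finset.prod_congr rfl fun a _ => ?_
        simp only [Nat.add_sub_cancel]
        ring
      have e4 : powWt (t (k + 1)) y (k + 1) U =
          t (k + 1) * y a ^ k * powWt (t (k + 1)) y (k + 1) (U.erase a) := by
        simp only [powWt]
        rw [← Finset.mul_prod_erase _ _ ha, Nat.add_sub_cancel]
      rw [e3, e4, levelWt, Nat.add_sub_cancel]
      ring
    rw [e1, e2, ← h]
    ring

theorem gen_shuffle_powWt
    (hcount : ∀ U : Finset ι, q ^ U.card = 1 + ∑ a ∈ U, (∏ b ∈ U.erase a, c a b) * (q - 1))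
    (t : ℂ) (k : ℕ) :
    shuffle c (gen fun a => (q - 1) * t * y a ^ (k - 1)) (powWt t y k) = powWt (q * t) y k := by
  funext U
  rw [gen_shuffle]
  have e1 : powWt (q * t) y k U = q ^ U.card * powWt t y k U := by
    simp only [powWt, mul_assoc, Finset.prod_mul_distrib, Finset.prod_const]
  rw [e1, hcount U, add_mul, one_mul, Finset.sum_mul]
  congr 1
  refine Finset.sum_congr rfl fun a ha => ?_
  have e2 : powWt t y k U = t * y a ^ (k - 1) * powWt t y k (U.erase a) := by
    simp only [powWt]
    rw [← Finset.mul_prod_erase _ _ ha]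
  rw [e2]
  ring

theorem boxSum_congr {s s' : ℕ → ι → ℂ} {N : ℕ} (h : ∀ k < N, s k = s' k) :
    boxSum c s N = boxSum c s' N := by
  induction N with
  | zero => rfl
  | succ N ih =>
    rw [boxSum, boxSum, h N (Nat.lt_succ_self N), ih fun k hk => h k (Nat.lt_succ_of_lt hk)]

theorem powWt_shuffle_boxSum
    (hnorm : ∀ U : Finset ι, 1 - ∏ a ∈ U, y a =
      ∑ a ∈ U, (∏ b ∈ U.erase a, c b a) * (∏ b ∈ U.erase a, y b) * (1 - y a))
    {t : ℕ → ℂ} {t₀ : ℂ} {N₀ N : ℕ} (ht : ∀ k, N₀ ≤ k → t k = t₀) (hN : N₀ ≤ N) :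
    shuffle c (powWt t₀ y N) (boxSum c (levelWt y t) N) =
      shuffle c (powWt t₀ y N₀) (boxSum c (levelWt y t) N₀) := by
  induction N, hN using Nat.le_induction with
  | base => rfl
  | succ N hN ih =>
    rw [boxSum, ← shuffle_assoc, ← ih, ← ht N hN, powWt_shuffle_levelWt hnorm]

theorem powWt_shuffle_boxSum_eq_qMoment
    (hnorm : ∀ U : Finset ι, 1 - ∏ a ∈ U, y a =
      ∑ a ∈ U, (∏ b ∈ U.erase a, c b a) * (∏ b ∈ U.erase a, y b) * (1 - y a))
    (hcount : ∀ U : Finset ι, q ^ U.card = 1 + ∑ a ∈ U, (∏ b ∈ U.erase a, c a b) * (q - 1))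
    {l : ℕ} {X : Fin l → ℕ} (hX : Antitone X) {N : ℕ} (hN : ∀ i, X i ≤ N) :
    shuffle c (powWt (q ^ l) y N) (boxSum c (levelWt y (heightWt q X)) N) =
      qMoment c q y l X := by
  induction l generalizing N with
  | zero =>
    rw [powWt_shuffle_boxSum hnorm (N₀ := 0) (by simp [heightWt]) (Nat.zero_le N)]
    funext U
    simp [boxSum, shuffle_gen, powWt, qMoment]
  | succ l ih =>
    have ht : ∀ k, X 0 ≤ k → heightWt q X k = q ^ (l + 1) := by
      intro k hk
      simp [heightWt, fun i => (hX (Fin.zero_le i)).trans hk]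
    rw [powWt_shuffle_boxSum hnorm ht (hN 0), pow_succ', ← gen_shuffle_powWt hcount, shuffle_assoc,
      qMoment]
    congr 1
    rw [← ih (X := fun i => X i.succ) (fun i j hij => hX (Fin.succ_le_succ_iff.2 hij))
      (N := X 0) (fun i => hX (Fin.zero_le _))]
    congr 1
    refine boxSum_congr fun k hk => ?_
    funext a
    simp [levelWt, heightWt, Fin.prod_univ_succ, hk.not_ge]

theorem tendsto_boxSum {s : ℕ → ι → ℂ} {t : ℂ} {F : Finset ι → ℂ} {N₀ : ℕ}
    (hy : ∀ a, ‖y a‖ < 1)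
    (h : ∀ N, N₀ ≤ N → shuffle c (powWt t y N) (boxSum c s N) = F) (U : Finset ι) :
    Filter.Tendsto (fun N => boxSum c s N U) Filter.atTop (nhds (F U)) := by
  induction U using Finset.strongInduction with
  | H U ih =>
    have hpow (K : Finset ι) (hK : K.Nonempty) :
        Filter.Tendsto (fun N => powWt t y N K) Filter.atTop (nhds 0) := by
      obtain ⟨a, ha⟩ := hK
      have h1 (b : ι) : Filter.Tendsto (fun N => t * y b ^ (N - 1)) Filter.atTop (nhds 0) := by
        have := ((tendsto_pow_atTop_nhds_zero_of_norm_lt_one (hy b)).comp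
          (Filter.tendsto_sub_atTop_nat 1)).const_mul t
        simpa using this
      have h2 := tendsto_finsetProd K (fun b _ => h1 b)
      rwa [Finset.prod_eq_zero ha rfl] at h2
    have hterm : Filter.Tendsto (fun N => ∑ K ∈ U.powerset.erase ∅,
        (∏ a ∈ K, ∏ b ∈ U \ K, c a b) * powWt t y N K * boxSum c s N (U \ K))
        Filter.atTop (nhds 0) := by
      rw [← Finset.sum_const_zero (s := U.powerset.erase ∅)]
      refine tendsto_finsetSum _ fun K hK => ?_
      rw [Finset.mem_erase, Finset.mem_powerset] at hK
      have hne : K.Nonempty := Finset.nonempty_iff_ne_empty.2 hK.1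
      have h1 := ((hpow K hne).const_mul (∏ a ∈ K, ∏ b ∈ U \ K, c a b)).mul
        (ih (U \ K) (Finset.sdiff_ssubset hK.2 hne))
      simpa using h1
    have h2 := hterm.const_sub (F U)
    rw [sub_zero] at h2
    refine h2.congr' ?_
    filter_upwards [Filter.eventually_ge_atTop N₀] with N hN
    rw [← h N hN]
    unfold shuffle
    rw [← Finset.add_sum_erase _ _ (Finset.empty_mem_powerset U)]
    simp [powWt]

end Moments

theorem summable_pi_prod {ι : Type*} [Fintype ι] {g : ι → ℕ → ℝ} (hg0 : ∀ a k, 0 ≤ g a k)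
    (hg : ∀ a, Summable (g a)) : Summable fun m : ι → ℕ => ∏ a, g a (m a) := by
  classical
  refine summable_of_sum_le (c := ∏ a, ∑' k, g a k)
    (fun m => Finset.prod_nonneg fun a _ => hg0 a _) fun S => ?_
  have hS : S ⊆ Fintype.piFinset fun a => S.image fun m => m a := fun m hm =>
    Fintype.mem_piFinset.2 fun a => Finset.mem_image_of_mem _ hm
  refine (Finset.sum_le_sum_of_subset_of_nonneg hS
    fun m _ _ => Finset.prod_nonneg fun a _ => hg0 a _).trans ?_
  rw [← Finset.prod_univ_sum]
  exact Finset.prod_le_prod (fun a _ => Finset.sum_nonneg fun k _ => hg0 a k)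
    fun a _ => (hg a).sum_le_tsum _ fun k _ => hg0 a k

theorem tendsto_piFinset_range_atTop {ι : Type*} [Fintype ι] [DecidableEq ι] :
    Filter.Tendsto (fun N => Fintype.piFinset fun _ : ι => Finset.range N)
      Filter.atTop Filter.atTop := by
  refine Filter.tendsto_atTop_finset_of_monotone (fun N N' h => ?_) fun m => ?_
  · exact Fintype.piFinset_subset _ _ fun _ => Finset.range_subset_range.2 h
  · refine ⟨∑ a, m a + 1, Fintype.mem_piFinset.2 fun a => ?_⟩
    rw [Finset.mem_range, Nat.lt_succ_iff]
    exact Finset.single_le_sum (fun _ _ => Nat.zero_le _) (Finset.mem_univ a)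

theorem summable_configWt {ι : Type*} [Fintype ι] [DecidableEq ι] (c : ι → ι → ℂ) {y : ι → ℂ}
    (hy : ∀ a, ‖y a‖ < 1) {t : ℕ → ℂ} (ht : ∀ k, ‖t k‖ ≤ 1) :
    Summable (configWt c (levelWt y t) Finset.univ) := by
  have hsum : Summable fun m : ι → ℕ => ∏ a, (‖y a‖ ^ (m a - 1) + ‖y a‖ ^ m a) := by
    refine summable_pi_prod (g := fun a k => ‖y a‖ ^ (k - 1) + ‖y a‖ ^ k)
      (fun a k => by positivity) fun a => ?_
    have h1 := summable_geometric_of_lt_one (norm_nonneg _) (hy a)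
    refine Summable.add ?_ h1
    rw [← summable_nat_add_iff 1]
    simpa using h1
  refine (hsum.mul_left (∏ a : ι, ∏ b : ι, max 1 ‖c a b‖)).of_norm_bounded fun m => ?_
  have hpair : ‖∏ a : ι, ∏ b : ι, pairWt c m a b‖ ≤ ∏ a : ι, ∏ b : ι, max 1 ‖c a b‖ := by
    rw [norm_prod]
    refine Finset.prod_le_prod (fun _ _ => norm_nonneg _) fun a _ => ?_
    rw [norm_prod]
    refine Finset.prod_le_prod (fun _ _ => norm_nonneg _) fun b _ => ?_
    unfold pairWt
    split_ifs <;> simp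
  have hlevel : ‖∏ a : ι, levelWt y t (m a) a‖ ≤
      ∏ a : ι, (‖y a‖ ^ (m a - 1) + ‖y a‖ ^ m a) := by
    rw [norm_prod]
    refine Finset.prod_le_prod (fun _ _ => norm_nonneg _) fun a _ => ?_
    rw [levelWt, norm_mul]
    refine (mul_le_of_le_one_right (norm_nonneg _) (ht _)).trans ?_
    simpa using norm_sub_le (y a ^ (m a - 1)) (y a ^ m a)
  rw [configWt, norm_mul]
  exact mul_le_mul hpair hlevel (norm_nonneg _) ((norm_nonneg _).trans hpair)

theorem hasSum_configWt {ι : Type*} [Fintype ι] [DecidableEq ι] {c : ι → ι → ℂ} {y : ι → ℂ}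
    (hy : ∀ a, ‖y a‖ < 1) {q : ℂ} (hq : ‖q‖ ≤ 1)
    (hnorm : ∀ U : Finset ι, 1 - ∏ a ∈ U, y a =
      ∑ a ∈ U, (∏ b ∈ U.erase a, c b a) * (∏ b ∈ U.erase a, y b) * (1 - y a))
    (hcount : ∀ U : Finset ι, q ^ U.card = 1 + ∑ a ∈ U, (∏ b ∈ U.erase a, c a b) * (q - 1))
    {l : ℕ} {X : Fin l → ℕ} (hX : Antitone X) :
    HasSum (configWt c (levelWt y (heightWt q X)) Finset.univ)
      (qMoment c q y l X Finset.univ) := by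
  have ht (k : ℕ) : ‖heightWt q X k‖ ≤ 1 := by
    rw [heightWt, norm_prod]
    refine Finset.prod_le_one (fun _ _ => norm_nonneg _) fun i _ => ?_
    split_ifs
    · exact hq
    · simp
  have hS := (summable_configWt c hy ht).hasSum
  have h1 := hS.comp tendsto_piFinset_range_atTop
  have h2 := tendsto_boxSum (N₀ := ∑ i, X i) hy (fun N hN =>
    powWt_shuffle_boxSum_eq_qMoment hnorm hcount hX fun i =>
      (Finset.single_le_sum (fun _ _ => Nat.zero_le _) (Finset.mem_univ i)).trans hN) Finset.univ
  simp only [boxSum_eq_sum_configWt, Finset.mem_univ, if_true] at h2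
  rwa [tendsto_nhds_unique h1 h2] at hS

theorem hasSum_sign_of_hasSum {n : ℕ} {w : (Fin n → ℕ) → ℂ} {a : ℂ} (hw : HasSum w a)
    (hinj : ∀ m, ¬ Function.Injective m → w m = 0) :
    HasSum (fun ν : Sign n => ∑ σ : Equiv.Perm (Fin n), w (ν.1 ∘ σ.symm)) a := by
  have hstrict (ν : Sign n) (h : Function.Injective ν.1) :
      StrictMono (OrderDual.toDual ∘ ν.1) := by
    refine Monotone.strictMono_of_injective (fun i j hij => ?_) (OrderDual.toDual.injective.comp h)
    exact OrderDual.toDual_le_toDual.2 (ν.2 i j hij)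
  have hνinj (x : Sign n × Equiv.Perm (Fin n)) (h : w (x.1.1 ∘ x.2.symm) ≠ 0) :
      Function.Injective x.1.1 := by
    by_contra hx
    refine h (hinj _ fun h' => hx ?_)
    simpa [Function.comp_assoc] using h'.comp x.2.injective
  have key : HasSum (fun x : Sign n × Equiv.Perm (Fin n) => w (x.1.1 ∘ x.2.symm)) a := by
    refine (hasSum_iff_hasSum_of_ne_zero_bij (fun x => x.1.1.1 ∘ x.1.2.symm) ?_ ?_ ?_).1 hw
    · rintro ⟨⟨ν, σ⟩, hx⟩ ⟨⟨ν', σ'⟩, hx'⟩ h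
      have h1 := hνinj _ hx
      have h2 := hνinj _ hx'
      dsimp only at h h1 h2
      have hr : Set.range ν.1 = Set.range ν'.1 := by
        rw [← σ.symm.surjective.range_comp ν.1, h, σ'.symm.surjective.range_comp]
      have h3 : OrderDual.toDual ∘ ν.1 = OrderDual.toDual ∘ ν'.1 :=
        ((hstrict ν h1).range_inj (hstrict ν' h2)).1
          (by rw [Set.range_comp, hr, Set.range_comp])
      have h4 : ν = ν' := Subtype.ext (OrderDual.toDual.injective.comp_left h3)
      subst h4
      have h5 : σ.symm = σ'.symm := Equiv.ext fun i => h1 (congrFun h i)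
      have h6 : σ = σ' := by rw [← σ.symm_symm, h5, σ'.symm_symm]
      subst h6
      rfl
    · intro m hm
      have hm' : Function.Injective m := by
        by_contra h
        exact hm (hinj m h)
      set σ := Tuple.sort (OrderDual.toDual ∘ m)
      have hmono : Monotone ((OrderDual.toDual ∘ m) ∘ σ) := Tuple.monotone_sort _
      have hc : (m ∘ σ) ∘ σ.symm = m := by
        funext i; simp
      refine ⟨⟨⟨⟨m ∘ σ, fun i j hij => hmono hij⟩, σ⟩, ?_⟩, hc⟩
      simpa [hc] using hm
    · intro x
      rfl
  exact key.prod_fiberwise fun ν => hasSum_fintype _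

theorem cconst_eq_prod (q s : ℂ) {n : ℕ} (lam : Fin n → ℕ) :
    cconst q s lam = ∏ k ∈ Finset.univ.image lam,
      qPoch (s ^ 2) q (mult lam k) / qPoch q q (mult lam k) := by
  refine finprod_eq_prod_of_mulSupport_subset _ fun k hk => ?_
  by_contra h
  refine hk ?_
  have : mult lam k = 0 := by
    rw [mult, Finset.card_eq_zero, Finset.filter_eq_empty_iff]
    intro i _ hi
    exact h (by simp [← hi])
  simp [this, qPoch]

theorem cconst_of_injective (q s : ℂ) {n : ℕ} {lam : Fin n → ℕ} (h : Function.Injective lam) :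
    cconst q s lam = ((1 - s ^ 2) / (1 - q)) ^ n := by
  have hm (i : Fin n) : mult lam (lam i) = 1 := by
    rw [mult, Finset.card_eq_one]
    exact ⟨i, by ext j; simp [h.eq_iff]⟩
  rw [cconst_eq_prod, Finset.prod_image (fun i _ j _ hij => h hij)]
  simp [hm, qPoch, div_pow]

theorem cconst_of_not_injective {q s : ℂ} (hs : q * s ^ 2 = 1) {n : ℕ} {lam : Fin n → ℕ}
    (h : ¬ Function.Injective lam) : cconst q s lam = 0 := by
  rw [Function.not_injective_iff] at h
  obtain ⟨i, j, hij, hne⟩ := h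
  rw [cconst_eq_prod]
  refine Finset.prod_eq_zero (Finset.mem_image_of_mem lam (Finset.mem_univ i)) ?_
  have h2 : 1 < mult lam (lam i) :=
    Finset.one_lt_card.2 ⟨i, by simp, j, by simp [hij], hne⟩
  have : qPoch (s ^ 2) q (mult lam (lam i)) = 0 :=
    Finset.prod_eq_zero (Finset.mem_range.2 h2) (by linear_combination -hs)
  rw [this, zero_div]

theorem prod_pow_height (q : ℂ) {n l : ℕ} (ν : Fin n → ℕ) (x : Fin l → ℕ) :
    ∏ i, q ^ height ν (x i) = ∏ j, heightWt q x (ν j) := by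
  simp only [heightWt]
  rw [Finset.prod_comm]
  refine Finset.prod_congr rfl fun i _ => ?_
  simp [height, Finset.prod_ite]

theorem Mwt_mul_prod_height_eq_sum {q s : ℂ} (hs : q * s ^ 2 = 1) (hq1 : q ≠ 1) {n : ℕ}
    {u y : Fin n → ℂ} (h1 : ∀ a, s * u a ≠ 1)
    (hy : ∀ a, y a = (s * u a - s ^ 2) / (s * u a - 1)) {l : ℕ} (x : Fin l → ℕ) (ν : Sign n) :
    Mwt q s u ν.1 * ∏ i, q ^ height ν.1 (x i) = ∑ σ : Equiv.Perm (Fin n),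
      configWt (fun a b => (u a - q * u b) / (u a - u b)) (levelWt y (heightWt q x)) Finset.univ
        (ν.1 ∘ σ.symm) := by
  by_cases hpos : ∀ i, 1 ≤ ν.1 i
  swap
  · rw [Mwt, if_neg hpos, zero_mul, zero_mul, zero_mul]
    push Not at hpos
    obtain ⟨i, hi⟩ := hpos
    refine (Finset.sum_eq_zero fun σ _ => ?_).symm
    have : ν.1 i = 0 := by omega
    exact mul_eq_zero_of_right _
      (Finset.prod_eq_zero (Finset.mem_univ (σ i)) (by simp [levelWt, this]))
  by_cases hinj : Function.Injective ν.1
  swap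
  · have h2 : ¬ Function.Injective fun i => ν.1 i - 1 := fun h => hinj fun i j hij =>
      h (by simp [hij])
    rw [Mwt, Fc, cconst_of_not_injective hs h2, zero_mul, mul_zero, zero_mul]
    refine (Finset.sum_eq_zero fun σ _ => ?_).symm
    · rw [Function.not_injective_iff] at hinj
      obtain ⟨i, j, hij, hne⟩ := hinj
      exact configWt_eq_zero _ _ (Finset.mem_univ (σ i)) (Finset.mem_univ (σ j))
        (by simpa using hne) (by simpa using hij)
  have hanti : ∀ i j, ν.1 j < ν.1 i ↔ i < j := fun i j => by
    constructor
    · intro h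
      by_contra hij
      exact absurd (ν.2 j i (not_lt.1 hij)) (not_le.2 h)
    · intro h
      exact lt_of_le_of_ne (ν.2 i j h.le) fun h' => h.ne' (hinj h')
  have hinj' : Function.Injective fun i => ν.1 i - 1 := fun i j hij => hinj (by
    have := hpos i; have := hpos j; dsimp only at hij; omega)
  have hexp : ∑ i, ν.1 i - n = ∑ i, (ν.1 i - 1) := by
    rw [Finset.sum_tsub_distrib _ fun i _ => hpos i]
    simp
  rw [Mwt, if_pos hpos, Fc, cconst_of_injective q s hinj', Ffun, prod_pow_height, hexp,
    Finset.mul_sum, Finset.mul_sum, Finset.mul_sum, Finset.sum_mul]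
  refine Finset.sum_congr rfl fun σ _ => ?_
  have hpair : ∏ a, ∏ b, pairWt (fun a b => (u a - q * u b) / (u a - u b)) (ν.1 ∘ σ.symm) a b =
      ∏ p ∈ (Finset.univ : Finset (Fin n × Fin n)).filter (fun p => p.1 < p.2),
        (u (σ p.1) - q * u (σ p.2)) / (u (σ p.1) - u (σ p.2)) := by
    rw [Finset.prod_filter, Fintype.prod_prod_type, ← Equiv.prod_comp σ]
    refine Finset.prod_congr rfl fun i _ => ?_
    rw [← Equiv.prod_comp σ]
    refine Finset.prod_congr rfl fun j _ => ?_
    simp only [pairWt, Function.comp_apply, Equiv.symm_apply_apply, hanti, hinj.eq_iff]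
    simp
  have hlevel : ∏ a, levelWt y (heightWt q x) ((ν.1 ∘ σ.symm) a) a =
      ((∏ a, (1 - y a)) * ∏ i, y (σ i) ^ (ν.1 i - 1)) * ∏ j, heightWt q x (ν.1 j) := by
    rw [← Equiv.prod_comp σ, ← Equiv.prod_comp σ (fun a => 1 - y a), ← Finset.prod_mul_distrib,
      ← Finset.prod_mul_distrib]
    refine Finset.prod_congr rfl fun i _ => ?_
    obtain ⟨k, hk⟩ := Nat.exists_eq_add_of_le' (hpos i)
    simp only [levelWt, Function.comp_apply, Equiv.symm_apply_apply, hk, Nat.add_sub_cancel]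
    ring
  have hd (a : Fin n) : 1 - s * u a ≠ 0 := sub_ne_zero.2 (h1 a).symm
  have hy1 : ∏ a, (1 - y a) = (1 - s ^ 2) ^ n / ∏ a, (1 - s * u a) := by
    have : (1 - s ^ 2) ^ n = ∏ a : Fin n, (1 - s ^ 2) := by simp
    rw [this, ← Finset.prod_div_distrib]
    refine Finset.prod_congr rfl fun a _ => ?_
    have := sub_ne_zero.2 (h1 a)
    rw [hy, eq_div_iff (hd a)]
    field_simp
    ring
  have hy2 : ∏ i, y (σ i) ^ (ν.1 i - 1) = (-s) ^ (∑ i, (ν.1 i - 1)) *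
      ∏ i, ((u (σ i) - s) / (1 - s * u (σ i))) ^ (ν.1 i - 1) := by
    rw [← Finset.prod_pow_eq_pow_sum, ← Finset.prod_mul_distrib]
    refine Finset.prod_congr rfl fun i _ => ?_
    rw [← mul_pow]
    congr 1
    have := sub_ne_zero.2 (h1 (σ i))
    have := hd (σ i)
    rw [hy]
    rw [div_eq_iff (sub_ne_zero.2 (h1 (σ i)))]
    field_simp
    ring
  rw [configWt, hpair, hlevel, hy1, hy2, div_pow]
  have : (1 - q) ^ n ≠ 0 := pow_ne_zero _ (sub_ne_zero.2 hq1.symm)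
  field_simp

theorem torusIntegrable_of_continuous {l : ℕ} {f : (Fin l → ℂ) → ℂ} {c : Fin l → ℂ}
    {R : Fin l → ℝ} (hf : Continuous fun θ => f (torusMap c R θ)) : TorusIntegrable f c R :=
  hf.continuousOn.integrableOn_compact isCompact_Icc

theorem torusMap_cons {l : ℕ} (c : Fin (l + 1) → ℂ) (R : Fin (l + 1) → ℝ) (t : ℝ)
    (θ : Fin l → ℝ) : torusMap c R (Fin.cons t θ) =
      Fin.cons (circleMap (c 0) (R 0) t) (torusMap (fun i => c i.succ) (fun i => R i.succ) θ) := by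
  funext i
  refine Fin.cases ?_ (fun i => ?_) i <;> simp [torusMap, circleMap]

theorem iterInt_sum_circleIntegral {C : Type*} [Fintype C] {l : ℕ} (ctr : Fin l → C → ℂ)
    {rad : Fin l → C → ℝ} (hrad : ∀ i a, 0 ≤ rad i a) {f : (Fin l → ℂ) → ℂ}
    (hf : ∀ c : Fin l → C, Continuous fun θ =>
      f (torusMap (fun i => ctr i (c i)) (fun i => rad i (c i)) θ)) :
    iterInt l (fun i g => ∑ a, ∮ z in C(ctr i a, rad i a), g z) f =
      ∑ c : Fin l → C,
        torusIntegral f (fun i => ctr i (c i)) (fun i => rad i (c i)) := by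
  induction l with
  | zero =>
    simp only [iterInt, torusIntegral_dim0, Finset.univ_unique, Finset.sum_singleton]
    congr 1
    exact Subsingleton.elim _ _
  | succ l ih =>
    have hcons (a : C) (c : Fin l → C) : Continuous fun p : ℝ × (Fin l → ℝ) =>
        f (Fin.cons (circleMap (ctr 0 a) (rad 0 a) p.1)
          (torusMap (fun i => ctr i.succ (c i)) (fun i => rad i.succ (c i)) p.2)) := by
      have := (hf (Fin.cons a c)).comp
        (f := fun p : ℝ × (Fin l → ℝ) => (Fin.cons p.1 p.2 : Fin (l + 1) → ℝ)) (by fun_prop)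
      simpa [Function.comp_def, torusMap_cons] using this
    have hintegrable (a : C) (c : Fin l → C) : CircleIntegrable
        (fun z => torusIntegral (fun w => f (Fin.cons z w))
          (fun i => ctr i.succ (c i)) (fun i => rad i.succ (c i))) (ctr 0 a) (rad 0 a) := by
      refine Continuous.intervalIntegrable ?_ _ _
      refine continuous_parametric_integral_of_continuous ?_ isCompact_Icc
      have hd : Continuous fun x : ℝ × (Fin l → ℝ) => ∏ i : Fin l,
          (rad i.succ (c i) : ℂ) * Complex.exp (x.2 i * Complex.I) * Complex.I := by fun_prop
      exact hd.smul (hcons a c)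
    rw [iterInt, ← (Fin.consEquiv fun _ => C).sum_comp, Fintype.sum_prod_type]
    refine Finset.sum_congr rfl fun a _ => ?_
    trans ∮ z in C(ctr 0 a, rad 0 a), ∑ c : Fin l → C, torusIntegral (fun w => f (Fin.cons z w))
          (fun i => ctr i.succ (c i)) (fun i => rad i.succ (c i))
    · refine circleIntegral.integral_congr (hrad 0 a) fun z hz => ?_
      obtain ⟨t, rfl⟩ : z ∈ Set.range (circleMap (ctr 0 a) (rad 0 a)) := by
        rwa [range_circleMap, abs_of_nonneg (hrad 0 a)]
      exact ih (fun i => ctr i.succ) (fun i => hrad i.succ) fun c =>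
        (hcons a c).comp (Continuous.prodMk_right t)
    · rw [circleIntegral.integral_fun_sum fun c _ => hintegrable a c]
      refine Finset.sum_congr rfl fun c _ => ?_
      rw [torusIntegral_succ (torusIntegrable_of_continuous (hf _))]
      rfl

theorem prod_filter_lt_succ {l : ℕ} (g : Fin (l + 1) → Fin (l + 1) → ℂ) :
    ∏ p ∈ (Finset.univ : Finset (Fin (l + 1) × Fin (l + 1))).filter (fun p => p.1 < p.2),
        g p.1 p.2 =
      (∏ p ∈ (Finset.univ : Finset (Fin l × Fin l)).filter (fun p => p.1 < p.2),
        g p.1.castSucc p.2.castSucc) * ∏ i : Fin l, g i.castSucc (Fin.last l) := by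
  simp only [Finset.prod_filter, Fintype.prod_prod_type, Fin.prod_univ_castSucc,
    Finset.prod_mul_distrib]
  simp [Fin.castSucc_lt_last, Fin.not_lt.2 (Fin.le_last _)]

theorem prod_filter_lt_succ' {l : ℕ} (g : Fin (l + 1) → Fin (l + 1) → ℂ) :
    ∏ p ∈ (Finset.univ : Finset (Fin (l + 1) × Fin (l + 1))).filter (fun p => p.1 < p.2),
        g p.1 p.2 =
      (∏ i : Fin l, g 0 i.succ) *
        ∏ p ∈ (Finset.univ : Finset (Fin l × Fin l)).filter (fun p => p.1 < p.2),
          g p.1.succ p.2.succ := by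
  simp only [Finset.prod_filter, Fintype.prod_prod_type, Fin.prod_univ_succ]
  simp

theorem torusMap_mem_sphere {l : ℕ} (p : Fin l → ℂ) {R : Fin l → ℝ} (hR : ∀ i, 0 < R i)
    (θ : Fin l → ℝ) (i : Fin l) : torusMap p R θ i ∈ Metric.sphere (p i) (R i) :=
  circleMap_mem_sphere (p i) (hR i).le (θ i)

/-- The integrand with simple poles at the centres of the torus. -/
def poleIntegrand {l : ℕ} (q : ℂ) (p : Fin l → ℂ) (h : Fin l → ℂ → ℂ) (w : Fin l → ℂ) : ℂ :=
  (∏ e ∈ (Finset.univ : Finset (Fin l × Fin l)).filter (fun e => e.1 < e.2),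
    (w e.1 - w e.2) / (w e.1 - q * w e.2)) * ∏ i, h i (w i) / (w i - p i)

theorem continuous_poleIntegrand_torusMap {l : ℕ} {q : ℂ} {p : Fin l → ℂ} {R : Fin l → ℝ}
    (hR : ∀ i, 0 < R i) {h : Fin l → ℂ → ℂ}
    (hh : ∀ i, ContinuousOn (h i) (Metric.sphere (p i) (R i)))
    (hne : ∀ i j, i < j → ∀ z ∈ Metric.sphere (p i) (R i),
      ∀ w ∈ Metric.sphere (p j) (R j), z ≠ q * w) :
    Continuous fun θ => poleIntegrand q p h (torusMap p R θ) := by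
  have hc (i : Fin l) : Continuous fun θ => torusMap p R θ i := by
    unfold torusMap
    fun_prop
  have hs := torusMap_mem_sphere p hR
  refine Continuous.mul (continuous_finsetProd _ fun e he => ?_)
    (continuous_finsetProd _ fun i _ => ?_)
  · exact ((hc _).sub (hc _)).div ((hc _).sub (continuous_const.mul (hc _))) fun θ =>
      sub_ne_zero.2 (hne _ _ (Finset.mem_filter.1 he).2 _ (hs θ _) _ (hs θ _))
  · refine Continuous.div ((hh i).comp_continuous (hc i) fun θ => hs θ i)
      ((hc i).sub continuous_const) fun θ => sub_ne_zero.2 ?_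
    exact Metric.ne_of_mem_sphere (hs θ i) (hR i).ne'

theorem torusIntegral_poleIntegrand {l : ℕ} {q : ℂ} {p : Fin l → ℂ} {R : Fin l → ℝ}
    (hR : ∀ i, 0 < R i) {h : Fin l → ℂ → ℂ}
    (hh : ∀ i, DifferentiableOn ℂ (h i) (Metric.closedBall (p i) (R i)))
    (hne : ∀ i j, i < j → ∀ z ∈ Metric.closedBall (p i) (R i),
      ∀ w ∈ Metric.sphere (p j) (R j), z ≠ q * w)
    {k : Fin l → Fin l → ℂ → ℂ}
    (hk : ∀ i j, i < j → DifferentiableOn ℂ (k i j) (Metric.closedBall (p j) (R j)))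
    (hkeq : ∀ i j, i < j → ∀ w ∈ Metric.sphere (p j) (R j),
      (p i - w) / (p i - q * w) = k i j w) :
    torusIntegral (poleIntegrand q p h) p R =
      (2 * (Real.pi : ℂ) * Complex.I) ^ l * (∏ i, h i (p i)) *
        ∏ e ∈ (Finset.univ : Finset (Fin l × Fin l)).filter (fun e => e.1 < e.2),
          k e.1 e.2 (p e.2) := by
  induction l with
  | zero => simp [poleIntegrand]
  | succ l ih =>
    have hintegrable : TorusIntegrable (poleIntegrand q p h) p R :=
      torusIntegrable_of_continuous <| continuous_poleIntegrand_torusMap hR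
        (fun i => (hh i).continuousOn.mono Metric.sphere_subset_closedBall)
        fun i j hij z hz => hne i j hij z (Metric.sphere_subset_closedBall hz)
    rw [torusIntegral_succAbove hintegrable (Fin.last l)]
    set pl := p (Fin.last l)
    set Rl := R (Fin.last l)
    set A := (2 * (Real.pi : ℂ) * Complex.I) ^ l * (∏ i : Fin l, h i.castSucc (p i.castSucc)) *
        ∏ e ∈ (Finset.univ : Finset (Fin l × Fin l)).filter (fun e => e.1 < e.2),
          k e.1.castSucc e.2.castSucc (p e.2.castSucc) with hA
    set g : ℂ → ℂ := fun w =>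
      A * ((∏ i : Fin l, k i.castSucc (Fin.last l) w) * h (Fin.last l) w) with hg
    have hlast (i : Fin l) : i.castSucc < Fin.last l := Fin.castSucc_lt_last i
    have hgd : DifferentiableOn ℂ g (Metric.closedBall pl Rl) :=
      ((DifferentiableOn.fun_finsetProd fun i _ => hk _ _ (hlast i)).mul (hh _)).const_mul A
    have hinner : Set.EqOn (fun w => torusIntegral
        (fun z => poleIntegrand q p h ((Fin.last l).insertNth w z))
        (p ∘ (Fin.last l).succAbove) (R ∘ (Fin.last l).succAbove))
        (fun w => (w - pl)⁻¹ • g w) (Metric.sphere pl Rl) := by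
      intro w hw
      have hd (i : Fin l) : DifferentiableOn ℂ (fun z => h i.castSucc z * ((z - w) / (z - q * w)))
          (Metric.closedBall (p i.castSucc) (R i.castSucc)) := by
        refine (hh _).mul (DifferentiableOn.div (by fun_prop) (by fun_prop) fun z hz => ?_)
        exact sub_ne_zero.2 (hne _ _ (hlast i) z hz w hw)
      have key := ih (p := fun i => p i.castSucc) (R := fun i => R i.castSucc)
        (fun i => hR _) hd (fun i j hij => hne _ _ (Fin.castSucc_lt_castSucc_iff.2 hij))
        (k := fun i j => k i.castSucc j.castSucc)
        (fun i j hij => hk _ _ (Fin.castSucc_lt_castSucc_iff.2 hij))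
        (fun i j hij => hkeq _ _ (Fin.castSucc_lt_castSucc_iff.2 hij))
      have hfac (z : Fin l → ℂ) : poleIntegrand q p h ((Fin.last l).insertNth w z) =
          (h (Fin.last l) w / (w - pl)) * poleIntegrand q (fun i => p i.castSucc)
            (fun i z => h i.castSucc z * ((z - w) / (z - q * w))) z := by
        rw [Fin.insertNth_last', poleIntegrand,
          prod_filter_lt_succ fun i j => ((Fin.snoc z w : Fin (l + 1) → ℂ) i -
            (Fin.snoc z w : Fin (l + 1) → ℂ) j) / ((Fin.snoc z w : Fin (l + 1) → ℂ) i -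
            q * (Fin.snoc z w : Fin (l + 1) → ℂ) j), poleIntegrand, Fin.prod_univ_castSucc]
        simp only [Fin.snoc_castSucc, Fin.snoc_last, mul_div_right_comm, Finset.prod_mul_distrib]
        ring
      have hcomp : p ∘ (Fin.last l).succAbove = fun i => p i.castSucc := by
        funext i; simp
      have hcomp' : R ∘ (Fin.last l).succAbove = fun i => R i.castSucc := by
        funext i; simp
      have hkw (i : Fin l) : (p i.castSucc - w) / (p i.castSucc - q * w) =
          k i.castSucc (Fin.last l) w := hkeq _ _ (hlast i) w hw
      simp only [hfac, torusIntegral_const_mul, hcomp, hcomp']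
      rw [key]
      simp only [hg, hA, hkw, Finset.prod_mul_distrib, smul_eq_mul]
      ring
    rw [circleIntegral.integral_congr (hR _).le hinner,
      (hgd.diffContOnCl_ball subset_rfl).circleIntegral_sub_inv_smul
        (Metric.mem_ball_self (hR _)), prod_filter_lt_succ fun i j => k i j (p j),
      Fin.prod_univ_castSucc, smul_eq_mul]
    simp only [hg, hA]
    ring

/-- The residue at a pole of the integrand of the moment formula: the pole at `0` is `none`, the
pole with label `a` is `some a`. -/
def residueWt {ι : Type*} [DecidableEq ι] (c : ι → ι → ℂ) (q : ℂ) (y : ι → ℂ) (U : Finset ι)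
    (k : ℕ) : Option ι → ℂ
  | none => 1
  | some a => if a ∈ U then (q - 1) * y a ^ (k - 1) * ∏ b ∈ U.erase a, c a b else 0

theorem mul_residueWt {ι : Type*} [DecidableEq ι] {c : ι → ι → ℂ} (q : ℂ) (y : ι → ℂ)
    {K : Option ι → Option ι → ℂ} (hKnone : ∀ a, K (some a) none = 1)
    (hKself : ∀ a, K (some a) (some a) = 0)
    (hKc : ∀ a b, a ≠ b → K (some a) (some b) * c b a = 1) {U : Finset ι} {a : ι} (ha : a ∈ U)
    (k : ℕ) (o : Option ι) :
    K (some a) o * residueWt c q y U k o = residueWt c q y (U.erase a) k o := by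
  cases o with
  | none => simp [residueWt, hKnone]
  | some b =>
    by_cases hab : a = b
    · subst hab
      simp [residueWt, hKself]
    by_cases hb : b ∈ U
    · have hb' : b ∈ U.erase a := Finset.mem_erase.2 ⟨Ne.symm hab, hb⟩
      have ha' : a ∈ U.erase b := Finset.mem_erase.2 ⟨hab, ha⟩
      simp only [residueWt, hb, hb', if_true]
      rw [← Finset.mul_prod_erase _ _ ha', Finset.erase_right_comm]
      linear_combination (q - 1) * y b ^ (k - 1) * (∏ d ∈ (U.erase a).erase b, c b d) *
        hKc a b hab
    · simp [residueWt, hb]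

theorem sum_residueWt_eq_qMoment {ι : Type*} [Fintype ι] [DecidableEq ι] {c : ι → ι → ℂ} {q : ℂ}
    (hq : q ≠ 0) (y : ι → ℂ) {K : Option ι → Option ι → ℂ} (hK : ∀ o, K none o = q⁻¹)
    (hKnone : ∀ a, K (some a) none = 1) (hKself : ∀ a, K (some a) (some a) = 0)
    (hKc : ∀ a b, a ≠ b → K (some a) (some b) * c b a = 1) {l : ℕ} (X : Fin l → ℕ)
    (U : Finset ι) :
    q ^ (l * (l - 1) / 2) * ∑ C : Fin l → Option ι, (∏ i, residueWt c q y U (X i) (C i)) *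
      ∏ e ∈ (Finset.univ : Finset (Fin l × Fin l)).filter (fun e => e.1 < e.2),
        K (C e.1) (C e.2) = qMoment c q y l X U := by
  induction l generalizing U with
  | zero => simp [qMoment]
  | succ l ih =>
    have hsplit (o : Option ι) : ∑ C : Fin l → Option ι,
        (∏ i, residueWt c q y U (X i) ((Fin.cons o C : Fin (l + 1) → Option ι) i)) *
        ∏ e ∈ (Finset.univ : Finset (Fin (l + 1) × Fin (l + 1))).filter (fun e => e.1 < e.2),
          K ((Fin.cons o C : Fin (l + 1) → Option ι) e.1)
            ((Fin.cons o C : Fin (l + 1) → Option ι) e.2) =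
        residueWt c q y U (X 0) o * ∑ C : Fin l → Option ι,
          (∏ i, K o (C i) * residueWt c q y U (X i.succ) (C i)) *
          ∏ e ∈ (Finset.univ : Finset (Fin l × Fin l)).filter (fun e => e.1 < e.2),
            K (C e.1) (C e.2) := by
      rw [Finset.mul_sum]
      refine Finset.sum_congr rfl fun C _ => ?_
      rw [prod_filter_lt_succ' fun i j => K ((Fin.cons o C : Fin (l + 1) → Option ι) i)
            ((Fin.cons o C : Fin (l + 1) → Option ι) j), Fin.prod_univ_succ]
      simp only [Fin.cons_zero, Fin.cons_succ, Finset.prod_mul_distrib]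
      ring
    rw [← (Fin.consEquiv fun _ => Option ι).sum_comp, Fintype.sum_prod_type, Fintype.sum_option]
    simp only [Fin.consEquiv_apply, hsplit]
    rw [qMoment, gen_shuffle, Nat.triangle_succ, pow_add, mul_add]
    congr 1
    · rw [← ih]
      simp only [hK, Finset.prod_mul_distrib, Finset.prod_const, Finset.card_univ,
        Fintype.card_fin, residueWt, one_mul, mul_assoc, ← Finset.mul_sum]
      rw [inv_pow, mul_inv_cancel_left₀ (pow_ne_zero _ hq)]
    · rw [Finset.mul_sum, ← Finset.sum_subset (Finset.subset_univ U)]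
      · refine Finset.sum_congr rfl fun a ha => ?_
        simp only [mul_residueWt q y hKnone hKself hKc ha]
        rw [← ih]
        simp only [residueWt, ha, if_true]
        ring
      · intro a _ ha
        simp [residueWt, ha]

/-- The poles of the integrand of the moment formula: `0` and the points `v j`. -/
def pole {ι : Type*} (v : ι → ℂ) : Option ι → ℂ
  | none => 0
  | some j => v j

/-- The one-variable integrand of the moment formula with its pole at `pole v o` removed. -/
def regularPart {ι : Type*} [Fintype ι] [DecidableEq ι] (q : ℂ) (v : ι → ℂ) (φ : ℂ → ℂ) (k : ℕ) :
    Option ι → ℂ → ℂ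
  | none => fun w => φ w ^ (k - 1) * ∏ j, (v j - q * w) / (v j - w)
  | some j => fun w => -(w⁻¹ * φ w ^ (k - 1) *
      ((∏ i ∈ Finset.univ.erase j, (v i - q * w) / (v i - w)) * (v j - q * w)))

/-- The cross factor `(a - w) / (a - q w)` at `a = pole v o`. -/
def crossFactor {ι : Type*} (q : ℂ) (v : ι → ℂ) : Option ι → ℂ → ℂ
  | none => fun _ => q⁻¹
  | some j => fun w => (v j - w) / (v j - q * w)

section Residues

variable {ι : Type*}

theorem regularPart_div [Fintype ι] [DecidableEq ι] (q : ℂ) (v : ι → ℂ) (φ : ℂ → ℂ) (k : ℕ)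
    (o : Option ι) (w : ℂ) : regularPart q v φ k o w / (w - pole v o) =
      w⁻¹ * φ w ^ (k - 1) * ∏ j, (v j - q * w) / (v j - w) := by
  cases o with
  | none =>
    simp only [regularPart, pole, sub_zero]
    ring
  | some j =>
    rw [← Finset.prod_erase_mul _ _ (Finset.mem_univ j)]
    simp only [regularPart, pole]
    rw [← neg_sub (v j) w, neg_div_neg_eq]
    ring

theorem regularPart_pole [Fintype ι] [DecidableEq ι] {q : ℂ} {v : ι → ℂ} (hv : ∀ j, v j ≠ 0)
    {φ : ℂ → ℂ} (hφ : φ 0 = 1) (k : ℕ) (o : Option ι) : regularPart q v φ k o (pole v o) =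
      residueWt (fun a b => (v b - q * v a) / (v b - v a)) q (fun a => φ (v a)) Finset.univ k o := by
  cases o with
  | none => simp [regularPart, pole, residueWt, hφ, hv]
  | some j =>
    simp only [regularPart, pole, residueWt, Finset.mem_univ, if_true]
    have := hv j
    field_simp
    ring

theorem crossFactor_eq_div {q : ℂ} (v : ι → ℂ) (o : Option ι) {w : ℂ} (hw : w ≠ 0) :
    (pole v o - w) / (pole v o - q * w) = crossFactor q v o w := by
  cases o with
  | none =>
    simp only [pole, crossFactor, zero_sub, neg_div_neg_eq]
    rw [div_mul_cancel_right₀ hw]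
  | some j => rfl

variable {q : ℝ} {v : ι → ℂ} {ε : ℝ}

theorem ne_pole_of_mem_closedBall (hP : ∀ o o', o ≠ o' → 4 * ε < ‖pole v o - pole v o'‖)
    {o o' : Option ι} (ho : o ≠ o') {R : ℝ} (hR : R < ε) {z : ℂ}
    (hz : z ∈ Metric.closedBall (pole v o) R) : z ≠ pole v o' := by
  rintro rfl
  have h1 := hP o o' ho
  rw [mem_closedBall_iff_norm, norm_sub_rev] at hz
  have := norm_nonneg (pole v o - pole v o')
  linarith

theorem ne_mul_of_mem_closedBall (hq0 : 0 < q) (hq1 : q < 1)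
    (hq : ∀ a o, 4 * ε < ‖v a - q * pole v o‖) {a : ι} {o : Option ι} {R R' : ℝ} (hR : R < ε)
    (hR' : R' < ε) {z w : ℂ} (hz : z ∈ Metric.closedBall (v a) R)
    (hw : w ∈ Metric.closedBall (pole v o) R') : z ≠ q * w := by
  rintro rfl
  have h1 := hq a o
  rw [mem_closedBall_iff_norm] at hz hw
  have h2 : ‖(q : ℂ) * w - q * pole v o‖ ≤ ‖w - pole v o‖ := by
    rw [← mul_sub, norm_mul, Complex.norm_of_nonneg hq0.le]
    exact mul_le_of_le_one_left (norm_nonneg _) hq1.le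
  have h3 := norm_sub_le ((q : ℂ) * w - q * pole v o) (q * w - v a)
  rw [sub_sub_sub_cancel_left] at h3
  have := norm_nonneg (v a - q * pole v o)
  linarith

theorem differentiableOn_crossFactor (hq0 : 0 < q) (hq1 : q < 1)
    (hq : ∀ a o, 4 * ε < ‖v a - q * pole v o‖) (o o' : Option ι) {R : ℝ} (hR0 : 0 ≤ R)
    (hR : R < ε) :
    DifferentiableOn ℂ (crossFactor q v o) (Metric.closedBall (pole v o') R) := by
  cases o with
  | none => exact differentiableOn_const _
  | some a =>
    refine DifferentiableOn.div (by fun_prop) (by fun_prop) fun z hz => ?_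
    exact sub_ne_zero.2 (ne_mul_of_mem_closedBall hq0 hq1 hq hR hR
      (Metric.mem_closedBall_self hR0) hz)

theorem differentiableOn_regularPart [Fintype ι] [DecidableEq ι]
    (hP : ∀ o o', o ≠ o' → 4 * ε < ‖pole v o - pole v o'‖) (q : ℂ) {φ : ℂ → ℂ} (k : ℕ)
    (o : Option ι) {R : ℝ} (hR : R < ε)
    (hφ : DifferentiableOn ℂ φ (Metric.closedBall (pole v o) R)) :
    DifferentiableOn ℂ (regularPart q v φ k o) (Metric.closedBall (pole v o) R) := by
  have hfac (i : ι) (hi : o ≠ some i) : DifferentiableOn ℂ (fun w => (v i - q * w) / (v i - w))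
      (Metric.closedBall (pole v o) R) := by
    refine DifferentiableOn.div (by fun_prop) (by fun_prop) fun z hz => ?_
    exact sub_ne_zero.2 (ne_pole_of_mem_closedBall hP hi hR hz).symm
  cases o with
  | none =>
    exact (hφ.pow _).mul (DifferentiableOn.fun_finsetProd fun i _ => hfac i (by simp))
  | some j =>
    refine (((differentiableOn_id.inv fun z hz => ?_).mul (hφ.pow _)).mul
      ((DifferentiableOn.fun_finsetProd fun i hi => hfac i ?_).mul (by fun_prop))).neg
    · exact ne_pole_of_mem_closedBall hP (o' := none) (by simp) hR hz
    · simpa using (Finset.ne_of_mem_erase hi).symm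

theorem poleIntegrand_regularPart [Fintype ι] [DecidableEq ι] (q : ℂ) (v : ι → ℂ) (φ : ℂ → ℂ)
    {l : ℕ} (X : Fin l → ℕ) (C : Fin l → Option ι) :
    poleIntegrand q (fun i => pole v (C i)) (fun i => regularPart q v φ (X i) (C i)) = fun w =>
      (∏ e ∈ (Finset.univ : Finset (Fin l × Fin l)).filter (fun e => e.1 < e.2),
        (w e.1 - w e.2) / (w e.1 - q * w e.2)) *
      ∏ i, ((w i)⁻¹ * φ (w i) ^ (X i - 1) * ∏ j, (v j - q * w i) / (v j - w i)) := by
  funext w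
  simp only [poleIntegrand, regularPart_div]

theorem ne_mul_of_radii (hq0 : 0 < q) (hq1 : q < 1)
    (hP : ∀ o o', o ≠ o' → 4 * ε < ‖pole v o - pole v o'‖)
    (hq : ∀ a o, 4 * ε < ‖v a - q * pole v o‖) {o o' : Option ι} {R R' : ℝ} (hR : R < ε)
    (hR' : R' < ε) (hnone : o = none → R < q * ε) (hnone' : o = none → o' = none → R < q * R')
    {z w : ℂ} (hz : z ∈ Metric.closedBall (pole v o) R)
    (hw : w ∈ Metric.sphere (pole v o') R') : z ≠ q * w := by
  cases o with
  | some a =>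
    exact ne_mul_of_mem_closedBall hq0 hq1 hq hR hR' hz (Metric.sphere_subset_closedBall hw)
  | none =>
    rintro rfl
    rw [mem_closedBall_iff_norm, pole, sub_zero, norm_mul, Complex.norm_of_nonneg hq0.le] at hz
    rw [mem_sphere_iff_norm] at hw
    cases o' with
    | none =>
      rw [pole, sub_zero] at hw
      rw [hw] at hz
      exact absurd (hnone' rfl rfl) (not_lt.2 hz)
    | some b =>
      have h1 := hP (some b) none (by simp)
      have h2 := norm_sub_le w (w - v b)
      simp only [pole, sub_zero] at h1 hw
      rw [sub_sub_cancel, hw] at h2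
      have h3 : ‖w‖ < ε := lt_of_mul_lt_mul_left (hz.trans_lt (hnone rfl)) hq0.le
      have := norm_nonneg (v b)
      linarith

theorem torusIntegral_poleIntegrand_regularPart [Fintype ι] [DecidableEq ι] (hq0 : 0 < q)
    (hq1 : q < 1) (hP : ∀ o o', o ≠ o' → 4 * ε < ‖pole v o - pole v o'‖)
    (hq : ∀ a o, 4 * ε < ‖v a - q * pole v o‖)
    (hv : ∀ j, v j ≠ 0) {φ : ℂ → ℂ} (hφ0 : φ 0 = 1)
    {l : ℕ} (X : Fin l → ℕ) (C : Fin l → Option ι) {R : Fin l → ℝ} (hR0 : ∀ i, 0 < R i)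
    (hR : ∀ i, R i < ε) (hφ : ∀ i, DifferentiableOn ℂ φ (Metric.closedBall (pole v (C i)) (R i)))
    (hnone : ∀ i, C i = none → R i < q * ε)
    (hnone' : ∀ i j, i < j → C i = none → C j = none → R i < q * R j) :
    (Continuous fun θ => poleIntegrand q (fun i => pole v (C i))
      (fun i => regularPart q v φ (X i) (C i)) (torusMap (fun i => pole v (C i)) R θ)) ∧
    torusIntegral (poleIntegrand q (fun i => pole v (C i))
        (fun i => regularPart q v φ (X i) (C i))) (fun i => pole v (C i)) R =
      (2 * (Real.pi : ℂ) * Complex.I) ^ l *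
        ((∏ i, residueWt (fun a b => (v b - q * v a) / (v b - v a)) q (fun a => φ (v a))
          Finset.univ (X i) (C i)) *
        ∏ e ∈ (Finset.univ : Finset (Fin l × Fin l)).filter (fun e => e.1 < e.2),
          crossFactor q v (C e.1) (pole v (C e.2))) := by
  have hh (i : Fin l) := differentiableOn_regularPart hP q (X i) (C i) (hR i) (hφ i)
  have hne (i j : Fin l) (hij : i < j) (z : ℂ) (hz : z ∈ Metric.closedBall (pole v (C i)) (R i))
      (w : ℂ) (hw : w ∈ Metric.sphere (pole v (C j)) (R j)) : z ≠ q * w :=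
    ne_mul_of_radii hq0 hq1 hP hq (hR i) (hR j) (hnone i) (hnone' i j hij) hz hw
  refine ⟨continuous_poleIntegrand_torusMap hR0
    (fun i => (hh i).continuousOn.mono Metric.sphere_subset_closedBall)
    fun i j hij z hz => hne i j hij z (Metric.sphere_subset_closedBall hz), ?_⟩
  rw [torusIntegral_poleIntegrand hR0 hh hne
    (k := fun i j => crossFactor q v (C i))
    (fun i j _ => differentiableOn_crossFactor hq0 hq1 hq _ _ (hR0 j).le (hR j))
    fun i j _ w hw => crossFactor_eq_div v _ ?_]
  · simp only [regularPart_pole hv hφ0, mul_assoc]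
  · cases hC : C j with
    | none =>
      have h1 := Metric.ne_of_mem_sphere hw (hR0 j).ne'
      simpa [hC, pole] using h1
    | some a =>
      exact ne_pole_of_mem_closedBall hP (o := C j) (o' := none) (by simp [hC]) (hR j)
        (Metric.sphere_subset_closedBall hw)

theorem exists_pole_separation [Finite ι] (hP : ∀ o o', o ≠ o' → pole v o ≠ pole v o')
    (hq : ∀ a o, v a ≠ q * pole v o) (hv : ∀ a, ‖v a‖ < 1) :
    ∃ ε > 0, (∀ o o', o ≠ o' → 4 * ε < ‖pole v o - pole v o'‖) ∧
      (∀ a o, 4 * ε < ‖v a - q * pole v o‖) ∧ ∀ o, 4 * ε < 1 - ‖pole v o‖ := by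
  have hlt {x : ℝ} (hx : 0 < x) : ∀ᶠ ε in nhdsWithin (0 : ℝ) (Set.Ioi 0), 4 * ε < x := by
    filter_upwards [Ioo_mem_nhdsGT (show 0 < x / 4 by positivity)] with ε hε
    linarith [hε.2]
  have h1 := Filter.eventually_all.2 fun o => Filter.eventually_all.2 fun o' =>
    Filter.eventually_all.2 fun h : o ≠ o' => hlt (norm_pos_iff.2 (sub_ne_zero.2 (hP o o' h)))
  have h2 := Filter.eventually_all.2 fun a => Filter.eventually_all.2 fun o =>
    hlt (norm_pos_iff.2 (sub_ne_zero.2 (hq a o)))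
  have h3 : ∀ᶠ ε in nhdsWithin (0 : ℝ) (Set.Ioi 0), ∀ o, 4 * ε < 1 - ‖pole v o‖ := by
    refine Filter.eventually_all.2 fun o => hlt (sub_pos.2 ?_)
    cases o with
    | none => simp [pole]
    | some a => exact hv a
  obtain ⟨ε, hε1, hε2, hε3, hε⟩ := (h1.and (h2.and (h3.and self_mem_nhdsWithin))).exists
  exact ⟨ε, hε, hε1, hε2, hε3⟩

end Residues

theorem iterInt_moment_eq_qMoment {q : ℝ} (hq0 : 0 < q) (hq1 : q < 1) {ι : Type*} [Fintype ι]
    [DecidableEq ι] {v : ι → ℂ} {ε : ℝ} (hP : ∀ o o', o ≠ o' → 4 * ε < ‖pole v o - pole v o'‖)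
    (hq : ∀ a o, 4 * ε < ‖v a - q * pole v o‖) (hε : 0 < ε) {φ : ℂ → ℂ} (hφ0 : φ 0 = 1)
    {δ ρ r : ℝ} (hδ : δ ∈ Set.Ioo 0 ε) (hr : q⁻¹ < r) {l : ℕ} (hρ0 : 0 < ρ)
    (hρ : r ^ l * ρ < q * ε)
    (hφ : ∀ o R, R < ε → DifferentiableOn ℂ φ (Metric.closedBall (pole v o) R))
    (X : Fin l → ℕ) :
    (q : ℂ) ^ (l * (l - 1) / 2) * (1 / (2 * (Real.pi : ℂ) * Complex.I)) ^ l *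
      iterInt l (fun i g => (∑ j, ∮ z in C(v j, δ), g z) + ∮ z in C(0, r ^ ((i : ℕ) + 1) * ρ), g z)
        (fun w => (∏ e ∈ (Finset.univ : Finset (Fin l × Fin l)).filter (fun e => e.1 < e.2),
          (w e.1 - w e.2) / (w e.1 - q * w e.2)) *
          ∏ i, ((w i)⁻¹ * φ (w i) ^ (X i - 1) * ∏ j, (v j - q * w i) / (v j - w i))) =
      qMoment (fun a b => (v b - q * v a) / (v b - v a)) q (fun a => φ (v a)) l X Finset.univ := by
  set rad : Fin l → Option ι → ℝ := fun i o => o.elim (r ^ ((i : ℕ) + 1) * ρ) fun _ => δ with hrad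
  have hinv : 1 < q⁻¹ := (one_lt_inv₀ hq0).2 hq1
  have hr1 : 1 < r := hinv.trans hr
  have hqr : 1 < q * r := by
    have := mul_lt_mul_of_pos_left hr hq0
    rwa [mul_inv_cancel₀ hq0.ne'] at this
  have hsmall (i : Fin l) : r ^ ((i : ℕ) + 1) * ρ < q * ε :=
    (mul_le_mul_of_nonneg_right (pow_le_pow_right₀ hr1.le i.2) hρ0.le).trans_lt hρ
  have hrad0 (i : Fin l) (o : Option ι) : 0 < rad i o := by
    cases o with
    | none => exact mul_pos (pow_pos (by linarith) _) hρ0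
    | some a => exact hδ.1
  have hradε (i : Fin l) (o : Option ι) : rad i o < ε := by
    cases o with
    | none => exact (hsmall i).trans (mul_lt_of_lt_one_left hε hq1)
    | some a => exact hδ.2
  have hv (j : ι) : v j ≠ 0 := by
    intro h
    have := hP (some j) none (by simp)
    simp only [pole, h, sub_self, norm_zero] at this
    linarith
  have hops : (fun (i : Fin l) (g : ℂ → ℂ) =>
      (∑ j, ∮ z in C(v j, δ), g z) + ∮ z in C(0, r ^ ((i : ℕ) + 1) * ρ), g z) =
      fun i g => ∑ o, ∮ z in C(pole v o, rad i o), g z := by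
    funext i g
    rw [Fintype.sum_option, add_comm]
    rfl
  have key (C : Fin l → Option ι) := torusIntegral_poleIntegrand_regularPart hq0 hq1 hP hq hv hφ0 X
    C (R := fun i => rad i (C i)) (fun i => hrad0 i _) (fun i => hradε i _)
    (fun i => hφ _ _ (hradε i _)) (fun i hi => by simpa [hrad, hi] using hsmall i)
    (fun i j hij hi hj => by
      simp only [hrad, hi, hj, Option.elim_none]
      have h1 : r ^ ((i : ℕ) + 1) ≤ r ^ (j : ℕ) := pow_le_pow_right₀ hr1.le hij
      have h2 : 0 < r ^ (j : ℕ) * ρ := mul_pos (pow_pos (by linarith) _) hρ0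
      calc r ^ ((i : ℕ) + 1) * ρ ≤ r ^ (j : ℕ) * ρ := by gcongr
        _ < (q * r) * (r ^ (j : ℕ) * ρ) := lt_mul_of_one_lt_left h2 hqr
        _ = q * (r ^ ((j : ℕ) + 1) * ρ) := by ring)
  simp only [poleIntegrand_regularPart] at key
  rw [hops, iterInt_sum_circleIntegral (fun _ => pole v) (fun i o => (hrad0 i o).le)
    fun C => (key C).1]
  simp only [fun C => (key C).2, ← Finset.mul_sum]
  have hpi : (2 * (Real.pi : ℂ) * Complex.I) ≠ 0 := Complex.two_pi_I_ne_zero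
  rw [one_div, inv_pow, mul_assoc, inv_mul_cancel_left₀ (pow_ne_zero _ hpi)]
  refine sum_residueWt_eq_qMoment (K := fun o o' => crossFactor q v o (pole v o'))
    (Complex.ofReal_ne_zero.2 hq0.ne') _ (fun _ => rfl) (fun a => ?_) (fun a => ?_)
    (fun a b hab => ?_) X Finset.univ
  · simp [crossFactor, pole, hv]
  · simp [crossFactor, pole]
  · have h1 : v a - v b ≠ 0 := by
      intro h
      have := hP (some a) (some b) (by simpa using hab)
      simp only [pole, h, norm_zero] at this
      linarith
    have h2 : v a - q * v b ≠ 0 := by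
      intro h
      have := hq a (some b)
      simp only [pole, h, norm_zero] at this
      linarith
    simp only [crossFactor, pole]
    rw [← inv_div (v a - v b) (v a - q * v b)]
    exact mul_inv_cancel₀ (div_ne_zero h1 h2)

theorem hasSum_Mwt_mul_prod_height {q s : ℝ} (hq0 : 0 < q) (hq1 : q < 1) (hs0 : 0 < s)
    (hs : q * s ^ 2 = 1) {n : ℕ} {u : Fin n → ℝ} (hu : ∀ i, s < u i)
    (huinj : Function.Injective u) {l : ℕ} {X : Fin l → ℕ} (hX : Antitone X) :
    HasSum (fun ν : Sign n => Mwt (q : ℂ) s (fun i => (u i : ℂ)) ν.1 *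
        ∏ i, (q : ℂ) ^ height ν.1 (X i))
      (qMoment (fun a b => ((u a : ℂ) - q * u b) / (u a - u b)) q
        (fun a => ((s : ℂ) * u a - s ^ 2) / (s * u a - 1)) l X Finset.univ) := by
  have hs1 : 1 < s := by
    by_contra h
    have : s ^ 2 ≤ 1 := pow_le_one₀ hs0.le (not_lt.1 h)
    nlinarith
  have hsu (a : Fin n) : 0 < s * u a - 1 := by nlinarith [hu a]
  have hsC : (q : ℂ) * (s : ℂ) ^ 2 = 1 := by exact_mod_cast hs
  have huC : Function.Injective fun a => (u a : ℂ) := Complex.ofReal_injective.comp huinj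
  have hu0 (a : Fin n) : (u a : ℂ) ≠ 0 := by
    exact_mod_cast (hs0.trans (hu a)).ne'
  have h1 (a : Fin n) : (s : ℂ) * u a ≠ 1 := by
    have := (sub_pos.1 (hsu a)).ne'
    exact_mod_cast this
  have hne (a : Fin n) : (u a : ℂ) ≠ s := by
    exact_mod_cast (hu a).ne'
  have hy (a : Fin n) : ‖((s : ℂ) * u a - s ^ 2) / (s * u a - 1)‖ < 1 := by
    have : ((s : ℂ) * u a - s ^ 2) / (s * u a - 1) =
        (((s * u a - s ^ 2) / (s * u a - 1) : ℝ) : ℂ) := by push_cast; rfl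
    rw [this, Complex.norm_of_nonneg (div_nonneg (by nlinarith [hu a]) (hsu a).le),
      div_lt_one (hsu a)]
    nlinarith
  have hqn : ‖(q : ℂ)‖ ≤ 1 := by
    rw [Complex.norm_of_nonneg hq0.le]
    exact hq1.le
  have key := hasSum_sign_of_hasSum (hasSum_configWt hy hqn
    (c := fun a b => ((u a : ℂ) - q * u b) / (u a - u b))
    (fun U => one_sub_prod_eq_sum q s hsC _ _ huC hu0 h1 hne (fun _ => rfl) U)
    (fun U => q_pow_card_eq_sum q _ huC hu0 U) hX) fun m hm => by
      rw [Function.not_injective_iff] at hm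
      obtain ⟨i, j, hij, hne⟩ := hm
      exact configWt_eq_zero _ _ (Finset.mem_univ i) (Finset.mem_univ j) hne hij
  have hq1' : (q : ℂ) ≠ 1 := by exact_mod_cast hq1.ne
  simpa only [Mwt_mul_prod_height_eq_sum hsC hq1' h1 (fun _ => rfl) X] using key

/-- Corollary 10.1: the multi-point q-moments of the height function of the stochastic six
vertex model (the case `s = q^{-1/2}`) started from the empty configuration, with the contours
`γ[ū|j]` realized as small circles around the points `u_i⁻¹` together with a circle of radius
`r^j·ρ` around `0`. -/
theorem six_vertex_q_moments (q : ℝ) (hq : q ∈ Set.Ioo (0 : ℝ) 1)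
    (n : ℕ) (hn : 1 ≤ n) (u : Fin n → ℝ)
    (hub : ∀ i, (Real.sqrt q)⁻¹ < u i) (huinj : Function.Injective u)
    (huq : ∀ i j, u i ≠ q * u j) (r : ℝ) (hr : q⁻¹ < r)
    (l : ℕ) (hl : 1 ≤ l) (x : Fin l → ℕ) (hx1 : ∀ i, 1 ≤ x i)
    (hxdec : ∀ i j : Fin l, i ≤ j → x j ≤ x i) :
    ∃ δ₀ : ℝ, 0 < δ₀ ∧ ∃ ρ₀ : ℝ, 0 < ρ₀ ∧
      ∀ δ ∈ Set.Ioo (0 : ℝ) δ₀, ∀ ρ ∈ Set.Ioo (0 : ℝ) ρ₀,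
      Summable (fun ν : Sign n =>
        Mwt (q : ℂ) (((Real.sqrt q : ℝ) : ℂ))⁻¹ (fun i => (u i : ℂ)) ν.1 *
          ∏ i, (q : ℂ) ^ (height ν.1 (x i))) ∧
      ∑' ν : Sign n,
          Mwt (q : ℂ) (((Real.sqrt q : ℝ) : ℂ))⁻¹ (fun i => (u i : ℂ)) ν.1 *
            ∏ i, (q : ℂ) ^ (height ν.1 (x i))
        = (q : ℂ) ^ (l * (l - 1) / 2) * (1 / (2 * (Real.pi : ℂ) * Complex.I)) ^ l *
            iterInt l
              (fun i => fun g =>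
                (∑ j, ∮ z in C(((u j : ℂ))⁻¹, δ), g z) +
                  ∮ z in C(0, r ^ ((i : ℕ) + 1) * ρ), g z)
              (fun w =>
                (∏ p ∈ (Finset.univ : Finset (Fin l × Fin l)).filter (fun p => p.1 < p.2),
                  (w p.1 - w p.2) / (w p.1 - (q : ℂ) * w p.2)) *
                ∏ i, ((w i)⁻¹ *
                  ((1 - (((Real.sqrt q : ℝ) : ℂ))⁻¹ * w i) /
                    (1 - ((Real.sqrt q : ℝ) : ℂ) * w i)) ^ (x i - 1) *
                  ∏ j, (1 - (q : ℂ) * (u j : ℂ) * w i) / (1 - (u j : ℂ) * w i))) := by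
  obtain ⟨hq0, hq1⟩ := hq
  set t := Real.sqrt q with ht
  have ht0 : 0 < t := Real.sqrt_pos.2 hq0
  have htq : t ^ 2 = q := Real.sq_sqrt hq0.le
  have ht1 : t < 1 := by nlinarith
  have hu0 (i : Fin n) : 0 < u i := (inv_pos.2 ht0).trans (hub i)
  set v : Fin n → ℂ := fun i => ((u i : ℝ) : ℂ)⁻¹ with hv
  set φ : ℂ → ℂ := fun w => (1 - (t : ℂ)⁻¹ * w) / (1 - t * w) with hφ
  have huC (i : Fin n) : (u i : ℂ) ≠ 0 := by exact_mod_cast (hu0 i).ne'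
  have htC : (t : ℂ) ≠ 0 := by exact_mod_cast ht0.ne'
  have hv1 (i : Fin n) : ‖v i‖ < 1 := by
    rw [hv, norm_inv, Complex.norm_of_nonneg (hu0 i).le]
    exact inv_lt_one_of_one_lt₀ (((one_lt_inv₀ ht0).2 ht1).trans (hub i))
  have hpole (o o' : Option (Fin n)) (h : o ≠ o') : pole v o ≠ pole v o' := by
    cases o <;> cases o'
    · exact absurd rfl h
    · simpa [pole, hv] using (huC _).symm
    · simpa [pole, hv] using huC _
    · simpa [pole, hv, huinj.eq_iff] using h
  have hqv (a : Fin n) (o : Option (Fin n)) : v a ≠ q * pole v o := by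
    cases o with
    | none => simpa [pole, hv] using huC a
    | some b =>
      intro h
      refine huq b a ?_
      simp only [pole, hv] at h
      have h1 := huC a
      have h2 := huC b
      field_simp at h
      have h3 : u b = u a * q := by exact_mod_cast h
      rw [h3, mul_comm]
  obtain ⟨ε, hε, hP, hQ, hone⟩ := exists_pole_separation hpole hqv hv1
  have hr0 : 0 < r := (inv_pos.2 hq0).trans hr
  refine ⟨ε, hε, q * ε / r ^ l, by positivity, fun δ hδ ρ hρ => ?_⟩
  have hmom := hasSum_Mwt_mul_prod_height hq0 hq1 (inv_pos.2 ht0)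
    (by rw [inv_pow, htq, mul_inv_cancel₀ hq0.ne']) hub huinj (X := x) hxdec
  rw [Complex.ofReal_inv] at hmom
  refine ⟨hmom.summable, hmom.tsum_eq.trans ?_⟩
  have hφd (o : Option (Fin n)) (R : ℝ) (hR : R < ε) :
      DifferentiableOn ℂ φ (Metric.closedBall (pole v o) R) := by
    refine DifferentiableOn.div (by fun_prop) (by fun_prop) fun z hz h => ?_
    have h1 : ‖(t : ℂ) * z‖ = 1 := by rw [← sub_eq_zero.1 h, norm_one]
    rw [norm_mul, Complex.norm_of_nonneg ht0.le] at h1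
    rw [mem_closedBall_iff_norm] at hz
    have h2 := norm_le_norm_add_norm_sub' z (pole v o)
    have h3 := hone o
    nlinarith [norm_nonneg z]
  have key := iterInt_moment_eq_qMoment hq0 hq1 hP hQ hε (φ := φ) (by simp [hφ]) hδ hr hρ.1
    (by rw [mul_comm]; exact (lt_div_iff₀ (pow_pos hr0 l)).1 hρ.2) hφd x
  have hw (j : Fin n) (w : ℂ) : (1 - (q : ℂ) * u j * w) / (1 - u j * w) =
      (v j - q * w) / (v j - w) := by
    rw [← mul_div_mul_left (v j - q * w) (v j - w) (huC j)]
    simp only [hv, mul_sub, mul_inv_cancel₀ (huC j)]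
    ring
  simp only [hw]
  refine Eq.trans ?_ key.symm
  congr 1
  · funext a b
    have h1 := huC a
    have h2 := huC b
    rw [← mul_div_mul_left (v b - q * v a) (v b - v a) (mul_ne_zero h1 h2)]
    congr 1 <;> simp only [hv] <;> field_simp
  · funext a
    have h1 := huC a
    simp only [hφ]
    rw [← mul_div_mul_left (1 - (t : ℂ)⁻¹ * v a) (1 - t * v a) (mul_ne_zero (inv_ne_zero htC) h1)]
    congr 1 <;> simp only [hv] <;> field_simp

end
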